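/- arXiv:1806.03638 — 3 statements merged into one kernel-verified Lean document; each statement's English description precedes it below -/
import Mathlib

section
/- Vanishing of a period integral: for every r > 0 and all z, w ∈ ℂ with |Im z| < r, |Im w| < r and w − z ∉ L_r, one has ∫_{−π}^{π} [ H′(r, s + ir − z) + H′(r, s + ir − w) + (H(r, s + ir − w) − H(r, s + ir − z))·H(r, w − z) ] ds = 0, where H′ denotes the derivative of H(r,·) in its second variable. -/
open Complex

/-- The theta function Θ(r,z) = (1/i)·∑_{n∈ℤ} (−1)^n e^{−r(n+1/2)²} e^{(n+1/2)iz}. -/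
noncomputable def Theta (r : ℝ) (z : ℂ) : ℂ :=
  (1 / Complex.I) * ∑' n : ℤ, (-1 : ℂ) ^ n *
    Complex.exp (-(r : ℂ) * ((n : ℂ) + 1 / 2) ^ 2) *
    Complex.exp (((n : ℂ) + 1 / 2) * Complex.I * z)

/-- The Loewner kernel H(r,z) = 2 Θ′(r,z)/Θ(r,z). -/
noncomputable def Hker (r : ℝ) (z : ℂ) : ℂ := 2 * deriv (Theta r) z / Theta r z

/-- The lattice L_r = 2πℤ + 2irℤ. -/
def ThetaLattice (r : ℝ) : Set ℂ :=
  {z | ∃ m n : ℤ, z = 2 * (Real.pi : ℂ) * m + 2 * Complex.I * r * n}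

/-- Lattice point 2πm + 2irn. -/
noncomputable def latPt (r : ℝ) (p : ℤ × ℤ) : ℂ :=
  2 * (Real.pi : ℂ) * p.1 + 2 * Complex.I * (r : ℂ) * p.2

/-- The Weierstrass zeta function with periods (2π, 2ir). -/
noncomputable def wzeta (r : ℝ) (z : ℂ) : ℂ :=
  1 / z + ∑' p : ℤ × ℤ, if p = 0 then 0 else
    (1 / (z - latPt r p) + 1 / latPt r p + z / latPt r p ^ 2)

noncomputable def qP (q : ℝ) (m : ℕ) : ℝ := ∏ k ∈ Finset.range m, (1 + -q ^ (2 * (k + 1)))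

noncomputable def qd (q : ℝ) (m : ℤ) : ℝ := if m < 0 then 0 else (qP q m.toNat)⁻¹

lemma qP_pos {q : ℝ} (h0 : 0 < q) (h1 : q < 1) (m : ℕ) : 0 < qP q m := by
  refine Finset.prod_pos fun k _ => ?_
  have : q ^ (2 * (k + 1)) < 1 := pow_lt_one₀ h0.le h1 (by omega)
  linarith

lemma qd_rec {q : ℝ} (h0 : 0 < q) (h1 : q < 1) (m : ℤ) :
    qd q (m - 1) = (1 - (q ^ m) ^ 2) * qd q m := by
  unfold qd
  rcases lt_trichotomy m 0 with h | h | h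
  · rw [if_pos h, if_pos (by omega)]; simp
  · subst h; simp
  · rw [if_neg (by omega), if_neg (by omega)]
    obtain ⟨k, rfl⟩ : ∃ k : ℕ, m = k + 1 := ⟨(m - 1).toNat, by omega⟩
    have e1 : ((k : ℤ) + 1 - 1).toNat = k := by omega
    have e2 : ((k : ℤ) + 1).toNat = k + 1 := by omega
    rw [e1, e2]
    have hk := qP_pos h0 h1 k
    have hk1 := qP_pos h0 h1 (k + 1)
    have e3 : qP q (k + 1) = qP q k * (1 + -q ^ (2 * (k + 1))) := by
      unfold qP; rw [Finset.prod_range_succ]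
    have e4 : (q ^ ((k : ℤ) + 1)) ^ 2 = q ^ (2 * (k + 1)) := by
      have : q ^ ((k : ℤ) + 1) = q ^ (k + 1) := by exact_mod_cast rfl
      rw [this, ← pow_mul]; ring_nf
    rw [e4]
    have h5 : (1 - q ^ (2 * (k + 1))) ≠ 0 := by
      intro h; rw [e3] at hk1
      have : (1 + -q ^ (2 * (k + 1))) = 0 := by linarith
      rw [this] at hk1; simp at hk1
    rw [e3, ← sub_eq_add_neg]
    field_simp

noncomputable def qc (q : ℝ) (N : ℕ) (n : ℤ) : ℝ :=
  q ^ (n ^ 2) * qP q (2 * N) * qd q (N - n) * qd q (N + n)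

lemma qc_rec {q : ℝ} (h0 : 0 < q) (h1 : q < 1) (N : ℕ) (n : ℤ) :
    qc q (N + 1) n = (1 + q ^ (2 * (2 * N + 1))) * qc q N n
      + q ^ (2 * N + 1) * (qc q N (n - 1) + qc q N (n + 1)) := by
  have hq : q ≠ 0 := h0.ne'
  unfold qc
  have a1 := qd_rec h0 h1 (N + 1 - n)
  have a2 := qd_rec h0 h1 (N + 1 + n)
  have a3 := qd_rec h0 h1 (N - n)
  have a4 := qd_rec h0 h1 (N + n)
  have b0 : qP q (2 * (N + 1)) = qP q (2 * N) * (1 + -q ^ (2 * (2 * N + 1))) *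
      (1 + -q ^ (2 * (2 * N + 2))) := by
    have : 2 * (N + 1) = 2 * N + 1 + 1 := by ring
    rw [this]; unfold qP; rw [Finset.prod_range_succ, Finset.prod_range_succ]
  have e1 : ((N : ℤ) + 1 - n - 1) = N - n := by ring
  have e2 : ((N : ℤ) + 1 + n - 1) = N + n := by ring
  rw [e1] at a1
  rw [e2] at a2
  have f1 : ((N : ℤ) - (n - 1)) = N + 1 - n := by ring
  have f2 : ((N : ℤ) + (n - 1)) = N + n - 1 := by ring
  have f3 : ((N : ℤ) - (n + 1)) = N - n - 1 := by ring
  have f4 : ((N : ℤ) + (n + 1)) = N + 1 + n := by ring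
  rw [f1, f2, f3, f4, a3, a4, a1, a2, b0]
  push_cast
  have g1 : q ^ ((n - 1) ^ 2) = q ^ (n ^ 2) * (q ^ n)⁻¹ ^ 2 * q := by
    rw [show (n - 1) ^ 2 = n ^ 2 + (-n) * 2 + 1 by ring, zpow_add₀ hq, zpow_add₀ hq, zpow_mul]
    simp
  have g2 : q ^ ((n + 1) ^ 2) = q ^ (n ^ 2) * (q ^ n) ^ 2 * q := by
    rw [show (n + 1) ^ 2 = n ^ 2 + n * 2 + 1 by ring, zpow_add₀ hq, zpow_add₀ hq, zpow_mul]
    simp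
  rw [g1, g2]
  have k1 : q ^ ((N : ℤ) + 1 - n) = q ^ N * q * (q ^ n)⁻¹ := by
    rw [zpow_sub₀ hq, zpow_add₀ hq]; simp [div_eq_mul_inv]
  have k2 : q ^ ((N : ℤ) + 1 + n) = q ^ N * q * (q ^ n) := by
    rw [zpow_add₀ hq, zpow_add₀ hq]; simp
  have k3 : q ^ ((N : ℤ) - n) = q ^ N * (q ^ n)⁻¹ := by
    rw [zpow_sub₀ hq]; simp [div_eq_mul_inv]
  have k4 : q ^ ((N : ℤ) + n) = q ^ N * (q ^ n) := by
    rw [zpow_add₀ hq]; simp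
  rw [k1, k2, k3, k4]
  have k5 : q ^ (2 * (2 * N + 1)) = (q ^ N) ^ 4 * q ^ 2 := by ring
  have k6 : q ^ (2 * (2 * N + 2)) = (q ^ N) ^ 4 * q ^ 4 := by ring
  have k7 : q ^ (2 * N + 1) = (q ^ N) ^ 2 * q := by ring
  rw [k5, k6, k7]
  have hn : q ^ n ≠ 0 := zpow_ne_zero _ hq
  generalize q ^ n = X at *
  generalize q ^ N = Y at *
  generalize qd q _ = A
  generalize qd q _ = B
  generalize q ^ (n ^ 2) = Z
  generalize qP q _ = W
  field_simp
  ring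

lemma qfinite {q : ℝ} (h0 : 0 < q) (h1 : q < 1) (x : ℂ) (hx : x ≠ 0) (N : ℕ) :
    HasSum (fun n : ℤ => (qc q N n : ℂ) * x ^ n)
      (∏ k ∈ Finset.range N, ((1 + x * q ^ (2 * k + 1)) * (1 + x⁻¹ * q ^ (2 * k + 1)))) := by
  induction N with
  | zero =>
    have := hasSum_single (f := fun n : ℤ => (qc q 0 n : ℂ) * x ^ n) 0 (by
      intro n hn
      have : qc q 0 n = 0 := by
        unfold qc qd
        rcases lt_or_gt_of_ne hn with h | h
        · simp [h]
        · simp [h]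
      simp [this])
    simpa [qc, qd, qP] using this
  | succ N ih =>
    rw [Finset.prod_range_succ]
    have s1 := ((Equiv.subRight (1 : ℤ)).hasSum_iff).mpr ih
    have s2 := ((Equiv.addRight (1 : ℤ)).hasSum_iff).mpr ih
    have s := ((ih.mul_left (1 + (q : ℂ) ^ (2 * (2 * N + 1)))).add
      (s1.mul_left (q ^ (2 * N + 1) * x))).add (s2.mul_left (q ^ (2 * N + 1) * x⁻¹))
    have e1 : (fun n : ℤ => (qc q (N + 1) n : ℂ) * x ^ n) = (fun b =>
      (1 + (q : ℂ) ^ (2 * (2 * N + 1))) * ((qc q N b : ℂ) * x ^ b) +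
          (q : ℂ) ^ (2 * N + 1) * x * ((fun n : ℤ => (qc q N n : ℂ) * x ^ n) ∘ (Equiv.subRight 1)) b +
        (q : ℂ) ^ (2 * N + 1) * x⁻¹ * ((fun n : ℤ => (qc q N n : ℂ) * x ^ n) ∘ (Equiv.addRight 1)) b) := by
      funext n
      rw [qc_rec h0 h1]
      simp only [Function.comp, Equiv.coe_addRight, Equiv.subRight_apply]
      rw [zpow_sub_one₀ hx, zpow_add_one₀ hx]
      push_cast
      field_simp
      ring
    rw [e1]
    have e2 : ∀ S : ℂ, S * ((1 + x * (q : ℂ) ^ (2 * N + 1)) * (1 + x⁻¹ * (q : ℂ) ^ (2 * N + 1)))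
        = (1 + (q : ℂ) ^ (2 * (2 * N + 1))) * S + (q : ℂ) ^ (2 * N + 1) * x * S
          + (q : ℂ) ^ (2 * N + 1) * x⁻¹ * S := by
      intro S
      field_simp
      ring
    rw [e2]
    exact s

lemma sx {q : ℝ} (h0 : 0 < q) (h1 : q < 1) (y : ℂ) :
    Summable fun k : ℕ => ‖y * (q : ℂ) ^ (2 * k + 1)‖ := by
  have : Summable fun k : ℕ => (‖y‖ * q) * (q ^ 2) ^ k :=
    (summable_geometric_of_lt_one (by positivity) (by nlinarith)).mul_left _
  refine this.congr fun k => ?_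
  rw [norm_mul, norm_pow, Complex.norm_of_nonneg h0.le]
  ring

open Filter Topology in
lemma theta_ne_zero {q : ℝ} (h0 : 0 < q) (h1 : q < 1) (x : ℂ) (hx : x ≠ 0)
    (hsum : Summable fun n : ℤ => ‖((q ^ (n ^ 2) : ℝ) : ℂ) * x ^ n‖)
    (hp : ∀ k : ℕ, 1 + x * q ^ (2 * k + 1) ≠ 0) (hm : ∀ k : ℕ, 1 + x⁻¹ * q ^ (2 * k + 1) ≠ 0) :
    ∑' n : ℤ, ((q ^ (n ^ 2) : ℝ) : ℂ) * x ^ n ≠ 0 := by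
  -- the limit of `qP`
  have sq : Summable fun k : ℕ => ‖-q ^ (2 * (k + 1))‖ := by
    have : Summable fun k : ℕ => (q ^ 2) * (q ^ 2) ^ k :=
      (summable_geometric_of_lt_one (by positivity) (by nlinarith)).mul_left _
    refine this.congr fun k => ?_
    rw [norm_neg, Real.norm_of_nonneg (by positivity)]
    ring
  set K : ℝ := ∏' k : ℕ, (1 + -q ^ (2 * (k + 1))) with hK
  have tP : Tendsto (qP q) atTop (𝓝 K) :=
    (multipliable_one_add_of_summable sq).tendsto_prod_tprod_nat
  have hanti : Antitone (qP q) := by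
    refine antitone_nat_of_succ_le fun m => ?_
    have : qP q (m + 1) = qP q m * (1 + -q ^ (2 * (m + 1))) := by
      unfold qP; rw [Finset.prod_range_succ]
    rw [this]
    have := qP_pos h0 h1 m
    have : 0 ≤ q ^ (2 * (m + 1)) := by positivity
    nlinarith
  have hle1 : ∀ m, qP q m ≤ 1 := fun m => by
    have := hanti (Nat.zero_le m); simpa [qP] using this
  have hKle : ∀ m, K ≤ qP q m := fun m => hanti.le_of_tendsto tP m
  have hK0 : K ≠ 0 := by
    refine tprod_one_add_ne_zero_of_summable (fun k => ?_) sq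
    have : q ^ (2 * (k + 1)) < 1 := pow_lt_one₀ h0.le h1 (by omega)
    intro h; linarith
  have hKpos : 0 < K := lt_of_le_of_ne
    (ge_of_tendsto' tP fun m => (qP_pos h0 h1 m).le) hK0.symm
  have hd0 : ∀ m, 0 ≤ qd q m := fun m => by
    unfold qd; split_ifs
    · exact le_rfl
    · exact (inv_pos.mpr (qP_pos h0 h1 _)).le
  have hdle : ∀ m, qd q m ≤ K⁻¹ := fun m => by
    unfold qd; split_ifs
    · positivity
    · exact inv_anti₀ hKpos (hKle _)
  have td : Tendsto (qd q) atTop (𝓝 K⁻¹) := by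
    have t1 : Tendsto (fun m : ℤ => (qP q m.toNat)⁻¹) atTop (𝓝 K⁻¹) := by
      refine Tendsto.inv₀ (tP.comp ?_) hK0
      exact tendsto_atTop.mpr fun b => by
        filter_upwards [eventually_ge_atTop (b : ℤ)] with a ha
        omega
    refine t1.congr' ?_
    filter_upwards [eventually_ge_atTop (0 : ℤ)] with a ha
    unfold qd; rw [if_neg (by omega)]
  have tc : ∀ n : ℤ, Tendsto (fun N : ℕ => qc q N n) atTop (𝓝 (q ^ (n ^ 2) * K * K⁻¹ * K⁻¹)) := by
    intro n
    unfold qc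
    have u0 : Tendsto (fun N : ℕ => 2 * N) atTop atTop :=
      tendsto_atTop.mpr fun b => by filter_upwards [eventually_ge_atTop b] with a ha; omega
    have u1 : Tendsto (fun N : ℕ => (N : ℤ) - n) atTop atTop :=
      tendsto_atTop.mpr fun b => by
        filter_upwards [eventually_ge_atTop (b + n).toNat] with a ha; omega
    have u2 : Tendsto (fun N : ℕ => (N : ℤ) + n) atTop atTop :=
      tendsto_atTop.mpr fun b => by
        filter_upwards [eventually_ge_atTop (b - n).toNat] with a ha; omega
    exact (((tendsto_const_nhds).mul (tP.comp u0)).mul (td.comp u1)).mul (td.comp u2)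
  have tsum1 : Tendsto (fun N : ℕ => ∑' n : ℤ, (qc q N n : ℂ) * x ^ n) atTop
      (𝓝 (∑' n : ℤ, ((q ^ (n ^ 2) * K * K⁻¹ * K⁻¹ : ℝ) : ℂ) * x ^ n)) := by
    refine tendsto_tsum_of_dominated_convergence (hsum.mul_left (K⁻¹ * K⁻¹)) ?_ ?_
    · intro n
      exact ((Complex.continuous_ofReal.tendsto _).comp (tc n)).mul_const _
    · refine Eventually.of_forall fun N n => ?_
      rw [norm_mul, norm_mul, ← mul_assoc]
      refine mul_le_mul_of_nonneg_right ?_ (norm_nonneg _)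
      have hz : 0 < q ^ (n ^ 2) := zpow_pos h0 _
      have hn1 := qP_pos h0 h1 (2 * N)
      rw [Complex.norm_of_nonneg hz.le, Complex.norm_of_nonneg
        (by unfold qc; have := hd0 (N - n); have := hd0 (N + n); positivity)]
      unfold qc
      have l1 : q ^ (n ^ 2) * qP q (2 * N) ≤ q ^ (n ^ 2) * 1 :=
        mul_le_mul_of_nonneg_left (hle1 _) hz.le
      calc q ^ (n ^ 2) * qP q (2 * N) * qd q (N - n) * qd q (N + n)
          ≤ (q ^ (n ^ 2) * 1) * K⁻¹ * K⁻¹ := by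
            refine mul_le_mul (mul_le_mul l1 (hdle _) (hd0 _) (by positivity)) (hdle _) (hd0 _)
              (by positivity)
        _ = _ := by ring
  have hprod : Tendsto (fun N : ℕ => ∏ k ∈ Finset.range N,
      ((1 + x * (q : ℂ) ^ (2 * k + 1)) * (1 + x⁻¹ * q ^ (2 * k + 1)))) atTop
      (𝓝 ((∏' k : ℕ, (1 + x * (q : ℂ) ^ (2 * k + 1))) * ∏' k : ℕ, (1 + x⁻¹ * (q : ℂ) ^ (2 * k + 1)))) := by
    simp only [Finset.prod_mul_distrib]
    exact ((multipliable_one_add_of_summable (sx h0 h1 x)).tendsto_prod_tprod_nat).mul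
      ((multipliable_one_add_of_summable (sx h0 h1 x⁻¹)).tendsto_prod_tprod_nat)
  have e := tendsto_nhds_unique
    (hprod.congr fun N => ((qfinite h0 h1 x hx N).tsum_eq).symm) tsum1
  intro hz
  have : ∑' n : ℤ, ((q ^ (n ^ 2) * K * K⁻¹ * K⁻¹ : ℝ) : ℂ) * x ^ n = 0 := by
    have : (fun n : ℤ => ((q ^ (n ^ 2) * K * K⁻¹ * K⁻¹ : ℝ) : ℂ) * x ^ n)
        = fun n : ℤ => ((K * K⁻¹ * K⁻¹ : ℝ) : ℂ) * (((q ^ (n ^ 2) : ℝ) : ℂ) * x ^ n) := by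
      funext n; push_cast; ring
    rw [this, tsum_mul_left, hz, mul_zero]
  rw [this] at e
  exact mul_ne_zero (tprod_one_add_ne_zero_of_summable hp (sx h0 h1 x))
    (tprod_one_add_ne_zero_of_summable hm (sx h0 h1 x⁻¹)) e

lemma Theta_eq (r : ℝ) (z : ℂ) :
    Theta r z = (1 / I) * (cexp (-r / 4 + I * z / 2) *
      jacobiTheta₂ (1 / 2 + z / (2 * Real.pi) + I * r / (2 * Real.pi)) (I * r / Real.pi)) := by
  have hpi : (Real.pi : ℂ) ≠ 0 := by exact_mod_cast Real.pi_ne_zero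
  unfold Theta jacobiTheta₂
  rw [← tsum_mul_left (a := cexp _)]
  congr 2
  funext n
  unfold jacobiTheta₂_term
  rw [← Complex.exp_pi_mul_I, ← Complex.exp_int_mul, ← Complex.exp_add, ← Complex.exp_add,
    ← Complex.exp_add]
  congr 1
  field_simp
  ring_nf
  simp only [I_sq]
  ring

lemma tau_im {r : ℝ} (hr : 0 < r) : 0 < (I * r / Real.pi : ℂ).im := by
  have : (I * r / Real.pi : ℂ) = ((r / Real.pi : ℝ) : ℂ) * I := by push_cast; ring
  rw [this]
  simp
  have := Real.pi_pos
  positivity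

lemma Theta_differentiable {r : ℝ} (hr : 0 < r) : Differentiable ℂ (Theta r) := by
  have : Theta r = fun z => (1 / I) * (cexp (-r / 4 + I * z / 2) *
      jacobiTheta₂ (1 / 2 + z / (2 * Real.pi) + I * r / (2 * Real.pi)) (I * r / Real.pi)) :=
    funext (Theta_eq r)
  rw [this]
  have hj : Differentiable ℂ (fun u => jacobiTheta₂ u (I * r / Real.pi)) := fun u =>
    differentiableAt_jacobiTheta₂_fst u (tau_im hr)
  have h2 : Differentiable ℂ (fun z : ℂ => 1 / 2 + z / (2 * Real.pi) + I * r / (2 * Real.pi)) := by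
    fun_prop
  have h3 := hj.comp h2
  exact (Differentiable.mul (by fun_prop) h3).const_mul _

lemma Theta_ne_zero {r : ℝ} (hr : 0 < r) (z : ℂ) (h0 : 0 < z.im) (h2 : z.im < 2 * r) :
    Theta r z ≠ 0 := by
  have hpi : (Real.pi : ℂ) ≠ 0 := by exact_mod_cast Real.pi_ne_zero
  rw [Theta_eq]
  refine mul_ne_zero (by simp) (mul_ne_zero (Complex.exp_ne_zero _) ?_)
  have hterm : ∀ n : ℤ, jacobiTheta₂_term n (1 / 2 + z / (2 * Real.pi) + I * r / (2 * Real.pi))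
      (I * r / Real.pi) = ((Real.exp (-r) ^ (n ^ 2) : ℝ) : ℂ) * cexp (Real.pi * I - r + I * z) ^ n := by
    intro n
    unfold jacobiTheta₂_term
    rw [Complex.ofReal_zpow, Complex.ofReal_exp, ← Complex.exp_int_mul, ← Complex.exp_int_mul,
      ← Complex.exp_add]
    congr 1
    push_cast
    field_simp
    ring_nf
    simp only [I_sq]
    ring
  have hs := ((summable_jacobiTheta₂_term_iff (1 / 2 + z / (2 * Real.pi) + I * r / (2 * Real.pi))
      (I * r / Real.pi)).mpr (tau_im hr)).norm
  unfold jacobiTheta₂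
  simp only [hterm] at hs ⊢
  have hnx : ‖cexp (Real.pi * I - r + I * z)‖ = Real.exp (-r - z.im) := by
    rw [Complex.norm_exp]; simp; ring
  have hpow : ∀ k : ℕ, ‖((Real.exp (-r) : ℝ) : ℂ) ^ (2 * k + 1)‖ = Real.exp (-((2 * k + 1) * r)) := by
    intro k
    rw [norm_pow, Complex.norm_of_nonneg (Real.exp_pos _).le, ← Real.exp_nat_mul]
    congr 1; push_cast; ring
  have key : ∀ a : ℂ, 1 + a = 0 → ‖a‖ = 1 := by
    intro a ha
    rw [show a = -1 by linear_combination ha]; simp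
  refine theta_ne_zero (Real.exp_pos _) (by simpa using hr) _ (Complex.exp_ne_zero _) hs ?_ ?_
  · intro k hk
    have := key _ hk
    rw [norm_mul, hnx, hpow, ← Real.exp_add, Real.exp_eq_one_iff] at this
    have : 0 ≤ (k : ℝ) * r := by positivity
    linarith
  · intro k hk
    have := key _ hk
    rw [norm_mul, norm_inv, hnx, hpow, ← Real.exp_neg, ← Real.exp_add, Real.exp_eq_one_iff] at this
    rcases Nat.eq_zero_or_pos k with rfl | hk0
    · simp at this; linarith
    · have : (1 : ℝ) ≤ k := by exact_mod_cast hk0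
      nlinarith

lemma Theta_antiperiodic (r : ℝ) (z : ℂ) : Theta r (z + 2 * Real.pi) = -Theta r z := by
  unfold Theta
  rw [← mul_neg, ← tsum_neg]
  congr 2
  funext n
  have : cexp ((n + 1 / 2) * I * (z + 2 * Real.pi)) = -cexp ((n + 1 / 2) * I * z) := by
    rw [show ((n : ℂ) + 1 / 2) * I * (z + 2 * Real.pi)
      = (n + 1 / 2) * I * z + (n * (2 * Real.pi * I) + Real.pi * I) by ring,
      Complex.exp_add, Complex.exp_add, Complex.exp_int_mul_two_pi_mul_I, Complex.exp_pi_mul_I]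
    ring
  rw [this]; ring

lemma Hker_periodic (r : ℝ) (z : ℂ) : Hker r (z + 2 * Real.pi) = Hker r z := by
  unfold Hker
  have h : deriv (Theta r) (z + 2 * Real.pi) = -deriv (Theta r) z := by
    rw [← deriv_comp_add_const]
    have : (fun x => Theta r (x + 2 * Real.pi)) = fun x => -Theta r x :=
      funext (Theta_antiperiodic r)
    rw [this, deriv.fun_neg]
  rw [h, Theta_antiperiodic]
  simp [neg_div_neg_eq]

def stripS (r : ℝ) : Set ℂ := {z | 0 < z.im ∧ z.im < 2 * r}

lemma stripS_open (r : ℝ) : IsOpen (stripS r) :=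
  (isOpen_lt continuous_const Complex.continuous_im).inter
    (isOpen_lt Complex.continuous_im continuous_const)

lemma Hker_diffOn {r : ℝ} (hr : 0 < r) : DifferentiableOn ℂ (Hker r) (stripS r) := by
  have hd := Theta_differentiable hr
  have hd' : Differentiable ℂ (deriv (Theta r)) := by
    have := hd.differentiableOn.deriv (s := Set.univ) isOpen_univ
    exact differentiableOn_univ.mp this
  intro z hz
  unfold Hker
  exact ((hd'.const_mul 2 z).div (hd z) (Theta_ne_zero hr z hz.1 hz.2)).differentiableWithinAt

lemma integral_deriv {r : ℝ} (hr : 0 < r) (a : ℂ) (ha : a ∈ stripS r) :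
    IntervalIntegrable (fun s : ℝ => deriv (Hker r) (s + a)) MeasureTheory.volume (-Real.pi) Real.pi ∧
    IntervalIntegrable (fun s : ℝ => Hker r (s + a)) MeasureTheory.volume (-Real.pi) Real.pi ∧
    ∫ s in (-Real.pi)..Real.pi, deriv (Hker r) ((s : ℂ) + a) = 0 := by
  have hmem : ∀ s : ℝ, (s : ℂ) + a ∈ stripS r := fun s => by
    simpa [stripS] using ha
  have hD := Hker_diffOn hr
  have hline : Continuous fun s : ℝ => (s : ℂ) + a := by fun_prop
  have c1 : Continuous fun s : ℝ => Hker r (s + a) :=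
    hD.continuousOn.comp_continuous hline hmem
  have c2 : Continuous fun s : ℝ => deriv (Hker r) (s + a) :=
    (hD.deriv (stripS_open r)).continuousOn.comp_continuous hline hmem
  refine ⟨c2.intervalIntegrable _ _, c1.intervalIntegrable _ _, ?_⟩
  rw [intervalIntegral.integral_eq_sub_of_hasDerivAt (f := fun s : ℝ => Hker r (s + a))
    (fun s _ => ?_) (c2.intervalIntegrable _ _)]
  · have := Hker_periodic r (((-Real.pi : ℝ) : ℂ) + a)
    rw [← this, sub_eq_zero]
    congr 1; push_cast; ring
  · have h := ((hD _ (hmem s)).differentiableAt ((stripS_open r).mem_nhds (hmem s))).hasDerivAt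
    exact (h.comp_add_const (s : ℂ) a).comp_ofReal

lemma integral_const {r : ℝ} (hr : 0 < r) (y₁ y₂ : ℝ) (h1 : 0 < y₁) (h1' : y₁ < 2 * r)
    (h2 : 0 < y₂) (h2' : y₂ < 2 * r) :
    ∫ s in (-Real.pi)..Real.pi, Hker r ((s : ℂ) + y₁ * I) =
      ∫ s in (-Real.pi)..Real.pi, Hker r ((s : ℂ) + y₂ * I) := by
  have h := Complex.integral_boundary_rect_eq_zero_of_differentiableOn (Hker r)
    (⟨-Real.pi, y₁⟩ : ℂ) (⟨Real.pi, y₂⟩ : ℂ) ((Hker_diffOn hr).mono (by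
      intro z hz
      obtain ⟨_, hz⟩ := hz
      simp only [Set.mem_preimage] at hz
      have h3 : min y₁ y₂ ≤ z.im := hz.1
      have h4 : z.im ≤ max y₁ y₂ := hz.2
      exact ⟨lt_of_lt_of_le (lt_min h1 h2) h3, lt_of_le_of_lt h4 (max_lt h1' h2')⟩))
  simp only at h
  have hp : ∀ y : ℝ, Hker r ((Real.pi : ℂ) + y * I) = Hker r (((-Real.pi : ℝ) : ℂ) + y * I) := by
    intro y
    rw [← Hker_periodic r (((-Real.pi : ℝ) : ℂ) + y * I)]
    congr 1; push_cast; ring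
  simp only [hp] at h
  linear_combination h

lemma integral_shift {r : ℝ} (a : ℂ) :
    ∫ s in (-Real.pi)..Real.pi, Hker r ((s : ℂ) + a) =
      ∫ s in (-Real.pi)..Real.pi, Hker r ((s : ℂ) + a.im * I) := by
  have hper : Function.Periodic (fun s : ℝ => Hker r ((s : ℂ) + a.im * I)) (2 * Real.pi) := by
    intro s
    simp only
    rw [← Hker_periodic r ((s : ℂ) + a.im * I)]
    congr 1; push_cast; ring
  have e : ∀ s : ℝ, Hker r ((s : ℂ) + a) = (fun s : ℝ => Hker r ((s : ℂ) + a.im * I)) (s + a.re) := by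
    intro s
    simp only
    congr 1
    conv_lhs => rw [← Complex.re_add_im a]
    push_cast; ring
  simp only [e]
  rw [intervalIntegral.integral_comp_add_right (fun s : ℝ => Hker r ((s : ℂ) + a.im * I))]
  have := hper.intervalIntegral_add_eq (-Real.pi + a.re) (-Real.pi)
  convert this using 2 <;> ring

/-- Vanishing of a period integral for the Loewner kernel. -/
theorem period_integral_vanishes (r : ℝ) (hr : 0 < r) (z w : ℂ)
    (hz : |z.im| < r) (hw : |w.im| < r) (hzw : w - z ∉ ThetaLattice r) :
    (∫ s in (-Real.pi)..Real.pi,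
      (deriv (Hker r) ((s : ℂ) + Complex.I * r - z) +
       deriv (Hker r) ((s : ℂ) + Complex.I * r - w) +
       (Hker r ((s : ℂ) + Complex.I * r - w) -
         Hker r ((s : ℂ) + Complex.I * r - z)) * Hker r (w - z))) = 0 := by
  have az := abs_lt.mp hz
  have aw := abs_lt.mp hw
  have mz : (I * r - z) ∈ stripS r := by
    constructor <;> simp <;> linarith
  have mw : (I * r - w) ∈ stripS r := by
    constructor <;> simp <;> linarith
  obtain ⟨z1, z2, z3⟩ := integral_deriv hr _ mz
  obtain ⟨w1, w2, w3⟩ := integral_deriv hr _ mw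
  simp only [add_sub_assoc]
  rw [intervalIntegral.integral_add (z1.add w1) ((w2.sub z2).mul_const _),
    intervalIntegral.integral_add z1 w1, intervalIntegral.integral_mul_const,
    intervalIntegral.integral_sub w2 z2, z3, w3, integral_shift (I * r - w),
    integral_shift (I * r - z), integral_const hr _ _ mw.1 mw.2 mz.1 mz.2]
  simp
end

section
/- Positivity of the theta function on the real period interval: for every r > 0, Θ(r,x) is real for all real x, Θ(r,0) = Θ(r,2π) = 0, and Θ(r,x) > 0 for every x ∈ (0,2π); consequently Θ̃(r,x) > 0 for every x ∈ (0,2π). -/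
open Complex

/-- The theta function Θ̃(r,z) = Θ(r,z)·exp(z²/(4r)). -/
noncomputable def ThetaT (r : ℝ) (z : ℂ) : ℂ :=
  Theta r z * Complex.exp (z ^ 2 / (4 * (r : ℂ)))

lemma summable_quad_exp (A B C : ℂ) (hA : A.re < 0) :
    Summable (fun n : ℤ => cexp (A * (n : ℂ) ^ 2 + B * n + C)) := by
  have hpi : (Real.pi : ℂ) ≠ 0 := by exact_mod_cast Real.pi_ne_zero
  have h := (summable_jacobiTheta₂_term_iff (B / (2 * Real.pi * I)) (A / (Real.pi * I))).mpr (by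
    have : A / (Real.pi * I) = ((Real.pi⁻¹ : ℝ) : ℂ) * (-(A * I)) := by
      push_cast
      field_simp
      linear_combination A * Complex.I_sq
    rw [this, Complex.im_ofReal_mul]
    have : 0 < Real.pi⁻¹ := by positivity
    simp only [Complex.neg_im, Complex.mul_I_im]
    exact mul_pos this (by linarith))
  refine (h.mul_right (cexp C)).congr fun n => ?_
  rw [jacobiTheta₂_term, ← Complex.exp_add]
  congr 1
  field_simp
  ring

lemma fold_tsum (f : ℤ → ℂ) (hs : Summable f) :
    ∑' n : ℤ, f n = ∑' n : ℕ, (f (n : ℤ) + f (-((n : ℤ) + 1))) := by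
  have h1 : Summable (fun n : ℕ => f (n : ℤ)) := hs.comp_injective Nat.cast_injective
  have h2 : Summable (fun n : ℕ => f (-((n : ℤ) + 1))) :=
    hs.comp_injective (i := fun n : ℕ => -((n : ℤ) + 1)) (fun a b h => by simpa using h)
  rw [tsum_of_nat_of_neg_add_one h1 h2, h1.tsum_add h2]

lemma pos_of_dominated (u : ℕ → ℝ) (ρ : ℝ) (h0 : 0 < u 0) (hρ0 : 0 ≤ ρ) (hρ : ρ < 1 / 2)
    (h : ∀ n, |u n| ≤ ρ ^ n * u 0) : 0 < ∑' n, u n := by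
  have hg : Summable (fun n : ℕ => ρ ^ n * u 0) :=
    (summable_geometric_of_lt_one hρ0 (by linarith)).mul_right _
  have hs : Summable u := hg.of_norm_bounded h
  rw [hs.tsum_eq_zero_add]
  have hg1 : Summable (fun n : ℕ => ρ ^ (n + 1) * u 0) := (summable_nat_add_iff 1).mpr hg
  have hs1 : Summable (fun n : ℕ => u (n + 1)) := (summable_nat_add_iff 1).mpr hs
  have h1 : ∑' n : ℕ, -(ρ ^ (n + 1) * u 0) ≤ ∑' n, u (n + 1) :=
    hg1.neg.tsum_le_tsum (fun n => (abs_le.mp (h (n + 1))).1) hs1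
  rw [tsum_neg] at h1
  have h2 : ∑' n : ℕ, ρ ^ (n + 1) * u 0 = ρ / (1 - ρ) * u 0 := by
    rw [tsum_mul_right]
    simp_rw [pow_succ']
    rw [tsum_mul_left, tsum_geometric_of_lt_one hρ0 (by linarith)]
    rfl
  have h3 : ρ / (1 - ρ) < 1 := by rw [div_lt_one] <;> linarith
  nlinarith

lemma abs_sin_nat_mul (t : ℝ) (n : ℕ) : |Real.sin (n * t)| ≤ n * |Real.sin t| := by
  induction n with
  | zero => simp
  | succ k ih =>
    push_cast
    rw [add_mul, one_mul, Real.sin_add]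
    refine (abs_add_le _ _).trans ?_
    rw [abs_mul, abs_mul]
    have h1 := Real.abs_cos_le_one t
    have h2 := Real.abs_cos_le_one (k * t)
    have := mul_le_of_le_one_right (abs_nonneg (Real.sin (k * t))) h1
    have := mul_le_of_le_one_left (abs_nonneg (Real.sin t)) h2
    linarith

lemma two_mul_add_one_le (n : ℕ) : (2 * (n : ℝ) + 1) ≤ 3 ^ n := by
  have := one_add_mul_le_pow (a := (2 : ℝ)) (by norm_num) n
  norm_num at this
  linarith

lemma rho_lt : 3 * Real.exp (-2) < 1 / 2 := by
  have h := Real.exp_one_gt_d9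
  have : Real.exp (-2) = (Real.exp 1 ^ 2)⁻¹ := by
    rw [← Real.exp_nat_mul, ← Real.exp_neg]; norm_num
  rw [this, mul_inv_lt_iff₀ (by positivity)]
  nlinarith

lemma rho_pow (n : ℕ) : (3 * Real.exp (-2)) ^ n = 3 ^ n * Real.exp (-2 * n) := by
  rw [mul_pow, ← Real.exp_nat_mul]; ring_nf

/-- Folded sine series. -/
lemma theta_sine (r : ℝ) (hr : 0 < r) (x : ℝ) :
    Theta r x = ((∑' n : ℕ, 2 * ((-1) ^ n * Real.exp (-r * (n + 1 / 2) ^ 2) *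
      Real.sin ((n + 1 / 2) * x)) : ℝ) : ℂ) := by
  have hs : Summable (fun n : ℤ => (-1 : ℂ) ^ n *
    Complex.exp (-(r : ℂ) * ((n : ℂ) + 1 / 2) ^ 2) *
    Complex.exp (((n : ℂ) + 1 / 2) * Complex.I * x)) := by
    refine (summable_quad_exp (-r) (-r + I * x + Real.pi * I) (-r / 4 + I * x / 2)
      (by simpa using hr)).congr fun n => ?_
    have : (-1 : ℂ) ^ n = cexp (n * (Real.pi * I)) := by
      rw [Complex.exp_int_mul, Complex.exp_pi_mul_I]
    rw [this, ← Complex.exp_add, ← Complex.exp_add]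
    congr 1
    ring
  rw [Theta, fold_tsum _ hs,
    ← tsum_mul_left, Complex.ofReal_tsum]
  refine tsum_congr fun n => ?_
  have e1 : (-1 : ℂ) ^ (-((n : ℤ) + 1)) = -(-1) ^ n := by
    rw [zpow_neg, ← inv_zpow, inv_neg_one, zpow_add_one₀ (by norm_num)]; simp
  rw [e1]
  push_cast
  rw [Complex.sin]
  have e2 : (-((n : ℂ) + 1) + 1 / 2) ^ 2 = ((n : ℂ) + 1 / 2) ^ 2 := by ring
  have e3 : (-((n : ℂ) + 1) + 1 / 2) * I * x = -(((n : ℂ) + 1 / 2) * x) * I := by ring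
  have e4 : ((n : ℂ) + 1 / 2) * I * x = (((n : ℂ) + 1 / 2) * x) * I := by ring
  rw [e2, e3, e4, zpow_natCast, one_div, Complex.inv_I]
  ring

/-- Folded Gaussian series. -/
lemma theta_gauss (r : ℝ) (hr : 0 < r) (x : ℝ) :
    Theta r x = (((r / Real.pi) ^ (1 / 2 : ℝ))⁻¹ * ∑' n : ℕ, (-1) ^ n *
      (Real.exp (-(2 * Real.pi * n + Real.pi - x) ^ 2 / (4 * r)) -
       Real.exp (-(2 * Real.pi * n + Real.pi + x) ^ 2 / (4 * r))) : ℝ) := by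
  have hpi : (Real.pi : ℂ) ≠ 0 := by exact_mod_cast Real.pi_ne_zero
  have hrc : (r : ℂ) ≠ 0 := by exact_mod_cast hr.ne'
  have hm (n : ℤ) : (-1 : ℂ) ^ n = cexp (n * (Real.pi * I)) := by
    rw [Complex.exp_int_mul, Complex.exp_pi_mul_I]
  have ha : 0 < ((r / Real.pi : ℝ) : ℂ).re := by
    rw [Complex.ofReal_re]; positivity
  have hP := Complex.tsum_exp_neg_quadratic ha ((I * (x + Real.pi) - r) / (2 * Real.pi))
  have hL : Theta r x = (1 / I * cexp (-r / 4 + I * x / 2)) *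
      ∑' n : ℤ, cexp (-Real.pi * ((r / Real.pi : ℝ) : ℂ) * n ^ 2 +
        2 * Real.pi * ((I * (x + Real.pi) - r) / (2 * Real.pi)) * n) := by
    rw [Theta, mul_assoc]
    congr 1
    rw [← tsum_mul_left]
    refine tsum_congr fun n => ?_
    rw [hm, ← Complex.exp_add, ← Complex.exp_add, ← Complex.exp_add]
    congr 1
    push_cast
    field_simp
    ring
  have hG : (1 / I * cexp (-r / 4 + I * x / 2)) * ∑' n : ℤ,
      cexp (-Real.pi / ((r / Real.pi : ℝ) : ℂ) *
        (n + I * ((I * (x + Real.pi) - r) / (2 * Real.pi))) ^ 2) =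
      ∑' n : ℤ, (-1 : ℂ) ^ n * cexp (-(2 * Real.pi * n + Real.pi - x) ^ 2 / (4 * r)) := by
    rw [← (Equiv.addRight (1 : ℤ)).tsum_eq (fun n : ℤ =>
      cexp (-Real.pi / ((r / Real.pi : ℝ) : ℂ) *
        (n + I * ((I * (x + Real.pi) - r) / (2 * Real.pi))) ^ 2)), ← tsum_mul_left]
    refine tsum_congr fun n => ?_
    have hI : (1 / I : ℂ) = cexp (-(Real.pi / 2 * I)) := by
      rw [Complex.exp_neg, Complex.exp_pi_div_two_mul_I, one_div]
    rw [hm, hI, ← Complex.exp_add, ← Complex.exp_add, ← Complex.exp_add]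
    congr 1
    simp only [Equiv.coe_addRight]
    push_cast
    have key : (n : ℂ) + 1 + I * ((I * (x + Real.pi) - r) / (2 * Real.pi)) =
        ((2 * Real.pi * n + Real.pi - x) - I * r) / (2 * Real.pi) := by
      field_simp
      linear_combination (x + Real.pi : ℂ) * Complex.I_sq
    rw [key]
    field_simp
    linear_combination (-4 * r ^ 2 : ℂ) * Complex.I_sq
  have hs : Summable (fun n : ℤ => (-1 : ℂ) ^ n *
      cexp (-(2 * Real.pi * n + Real.pi - x) ^ 2 / (4 * r))) := by
    refine (summable_quad_exp (-((Real.pi ^ 2 / r : ℝ) : ℂ))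
      (-Real.pi * (Real.pi - x) / r + Real.pi * I) (-(Real.pi - x) ^ 2 / (4 * r))
      (by rw [Complex.neg_re, Complex.ofReal_re, neg_lt_zero]; positivity)).congr fun n => ?_
    rw [hm, ← Complex.exp_add]
    congr 1
    push_cast
    field_simp
    ring
  have hc : (1 : ℂ) / ((r / Real.pi : ℝ) : ℂ) ^ (1 / 2 : ℂ) =
      ((((r / Real.pi) ^ (1 / 2 : ℝ))⁻¹ : ℝ) : ℂ) := by
    rw [Complex.ofReal_inv, Complex.ofReal_cpow (by positivity)]
    simp
  rw [hL, hP, mul_left_comm, hG, hc, Complex.ofReal_mul]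
  congr 1
  rw [fold_tsum _ hs,
    Complex.ofReal_tsum]
  refine tsum_congr fun n => ?_
  have e1 : (-1 : ℂ) ^ (-((n : ℤ) + 1)) = -(-1) ^ n := by
    rw [zpow_neg, ← inv_zpow, inv_neg_one, zpow_add_one₀ (by norm_num)]; simp
  rw [e1]
  push_cast
  have e2 : (2 * (Real.pi : ℂ) * -((n : ℂ) + 1) + Real.pi - x) ^ 2 =
    (2 * Real.pi * n + Real.pi + x) ^ 2 := by ring
  rw [e2, zpow_natCast]
  ring

lemma theta_pos_large (r : ℝ) (hr : 1 ≤ r) (x : ℝ) (hx : x ∈ Set.Ioo 0 (2 * Real.pi)) :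
    0 < (Theta r x).re := by
  rw [theta_sine r (by linarith), Complex.ofReal_re]
  have hsin : 0 < Real.sin (x / 2) :=
    Real.sin_pos_of_pos_of_lt_pi (by linarith [hx.1]) (by linarith [hx.2])
  have e0 : (2 * ((-1) ^ 0 * Real.exp (-r * (((0 : ℕ) : ℝ) + 1 / 2) ^ 2) *
      Real.sin ((((0 : ℕ) : ℝ) + 1 / 2) * x)) : ℝ) =
      2 * (Real.exp (-r / 4) * Real.sin (x / 2)) := by
    push_cast; ring_nf
  refine pos_of_dominated _ (3 * Real.exp (-2)) ?_ (by positivity) rho_lt fun n => ?_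
  · rw [e0]; positivity
  · rw [e0, rho_pow]
    rw [abs_mul, abs_mul, abs_mul, abs_pow, abs_neg, abs_one, one_pow, one_mul, abs_two,
      Real.abs_exp]
    have h1 : |Real.sin ((n + 1 / 2) * x)| ≤ 3 ^ n * Real.sin (x / 2) := by
      have := abs_sin_nat_mul (x / 2) (2 * n + 1)
      rw [abs_of_pos hsin] at this
      push_cast at this
      rw [show (n + 1 / 2) * x = (2 * (n : ℝ) + 1) * (x / 2) by ring]
      exact this.trans (mul_le_mul_of_nonneg_right (two_mul_add_one_le n) hsin.le)
    have h2 : Real.exp (-r * (n + 1 / 2) ^ 2) ≤ Real.exp (-2 * n) * Real.exp (-r / 4) := by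
      rw [← Real.exp_add, Real.exp_le_exp]
      have hn : (n : ℝ) ≤ n ^ 2 := by
        exact_mod_cast Nat.le_self_pow two_ne_zero n
      nlinarith [(Nat.cast_nonneg n : (0 : ℝ) ≤ n)]
    have := mul_le_mul h2 h1 (abs_nonneg _) (by positivity)
    nlinarith

lemma theta_pos_small (r : ℝ) (hr : 0 < r) (hr1 : r ≤ 1) (x : ℝ) (hx0 : 0 < x)
    (hx1 : x ≤ Real.pi) : 0 < (Theta r x).re := by
  rw [theta_gauss r hr, Complex.ofReal_re]
  have hpi := Real.pi_gt_three
  refine mul_pos (by positivity) ?_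
  set s : ℝ := Real.pi * x / r with hs
  have hspos : 0 < s := by positivity
  have hes : Real.exp (-s) < 1 := by simpa using hspos
  have hterm (n : ℕ) : (Real.exp (-(2 * Real.pi * n + Real.pi - x) ^ 2 / (4 * r)) -
       Real.exp (-(2 * Real.pi * n + Real.pi + x) ^ 2 / (4 * r))) =
       Real.exp (-(2 * Real.pi * n + Real.pi - x) ^ 2 / (4 * r)) *
        (1 - Real.exp (-s) ^ (2 * n + 1)) := by
    rw [mul_sub, mul_one, ← Real.exp_nat_mul, ← Real.exp_add]
    congr 2
    rw [hs]
    push_cast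
    field_simp
    ring
  simp_rw [hterm]
  refine pos_of_dominated _ (3 * Real.exp (-2)) ?_ (by positivity) rho_lt fun n => ?_
  · simp only [pow_zero, one_mul, mul_zero, zero_add, pow_one]
    exact mul_pos (Real.exp_pos _) (by linarith)
  · rw [rho_pow]
    have h0 : 0 ≤ 1 - Real.exp (-s) ^ (2 * n + 1) :=
      sub_nonneg.mpr (pow_le_one₀ (Real.exp_pos _).le hes.le)
    rw [abs_mul, abs_mul, abs_pow, abs_neg, abs_one, one_pow, one_mul, Real.abs_exp,
      abs_of_nonneg h0]
    simp only [pow_zero, one_mul, mul_zero, zero_add, pow_one, Nat.cast_zero]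
    have h1 : 1 - Real.exp (-s) ^ (2 * n + 1) ≤ 3 ^ n * (1 - Real.exp (-s)) := by
      have := one_add_mul_le_pow (a := Real.exp (-s) - 1)
        (by linarith [Real.exp_pos (-s)]) (2 * n + 1)
      push_cast at this
      rw [add_sub_cancel] at this
      have h3 := mul_le_mul_of_nonneg_right (two_mul_add_one_le n) (sub_nonneg.mpr hes.le)
      linarith
    have h2 : Real.exp (-(2 * Real.pi * n + Real.pi - x) ^ 2 / (4 * r)) ≤
        Real.exp (-2 * n) * Real.exp (-(Real.pi - x) ^ 2 / (4 * r)) := by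
      rw [← Real.exp_add, Real.exp_le_exp]
      have hn : (n : ℝ) ≤ n ^ 2 := by
        exact_mod_cast Nat.le_self_pow two_ne_zero n
      have hn0 : (0 : ℝ) ≤ n := Nat.cast_nonneg n
      have hq : 8 * r * n ≤ (2 * Real.pi * n + Real.pi - x) ^ 2 - (Real.pi - x) ^ 2 := by
        have a1 : 0 ≤ Real.pi * n * (Real.pi - x) :=
          mul_nonneg (by positivity) (by linarith)
        have a2 : 9 * (n : ℝ) ≤ Real.pi ^ 2 * n ^ 2 :=
          mul_le_mul (by nlinarith) hn hn0 (by positivity)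
        nlinarith
      rw [← sub_nonneg]
      have : -2 * (n : ℝ) + -(Real.pi - x) ^ 2 / (4 * r) -
          -(2 * Real.pi * n + Real.pi - x) ^ 2 / (4 * r) =
          ((2 * Real.pi * n + Real.pi - x) ^ 2 - (Real.pi - x) ^ 2 - 8 * r * n) / (4 * r) := by
        field_simp
        ring
      rw [this]
      exact div_nonneg (by linarith) (by positivity)
    have := mul_le_mul h2 h1 h0 (by positivity)
    linarith

lemma theta_symm (r : ℝ) (hr : 0 < r) (x : ℝ) :
    Theta r ((2 * Real.pi - x : ℝ) : ℂ) = Theta r x := by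
  rw [theta_sine r hr, theta_sine r hr]
  congr 2
  funext n
  have : Real.sin (((n : ℝ) + 1 / 2) * (2 * Real.pi - x)) = Real.sin ((n + 1 / 2) * x) := by
    rw [show ((n : ℝ) + 1 / 2) * (2 * Real.pi - x) =
      (Real.pi - (n + 1 / 2) * x) + n * (2 * Real.pi) by ring,
      Real.sin_add_nat_mul_two_pi, Real.sin_pi_sub]
  rw [this]

lemma theta_pos_all (r : ℝ) (hr : 0 < r) (x : ℝ) (hx : x ∈ Set.Ioo 0 (2 * Real.pi)) :
    0 < (Theta r x).re := by
  rcases le_total 1 r with h | h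
  · exact theta_pos_large r h x hx
  · rcases le_total x Real.pi with h' | h'
    · exact theta_pos_small r hr h x hx.1 h'
    · rw [← theta_symm r hr]
      exact theta_pos_small r hr h _ (by linarith [hx.2]) (by linarith)

/-- Positivity of the theta function on the real period interval. -/
theorem theta_positive (r : ℝ) (hr : 0 < r) :
    (∀ x : ℝ, (Theta r (x : ℂ)).im = 0) ∧
    Theta r 0 = 0 ∧
    Theta r ((2 * Real.pi : ℝ) : ℂ) = 0 ∧
    (∀ x : ℝ, x ∈ Set.Ioo 0 (2 * Real.pi) → 0 < (Theta r (x : ℂ)).re) ∧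
    (∀ x : ℝ, x ∈ Set.Ioo 0 (2 * Real.pi) → 0 < (ThetaT r (x : ℂ)).re) := by
  have him : ∀ x : ℝ, (Theta r (x : ℂ)).im = 0 := fun x => by
    rw [theta_sine r hr, Complex.ofReal_im]
  have h0 : Theta r 0 = 0 := by
    have := theta_sine r hr 0
    simpa using this
  refine ⟨him, h0, ?_, theta_pos_all r hr, fun x hx => ?_⟩
  · have := theta_symm r hr 0
    rw [sub_zero] at this
    rw [this, Complex.ofReal_zero, h0]
  · have e : Complex.exp ((x : ℂ) ^ 2 / (4 * (r : ℂ))) = ((Real.exp (x ^ 2 / (4 * r)) : ℝ) : ℂ) := by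
      push_cast
      rfl
    rw [ThetaT, e, Complex.re_mul_ofReal]
    exact mul_pos (theta_pos_all r hr x hx) (Real.exp_pos _)
end

section
/- Null-vector equation for the screening integrand (excursion-reflected case): fix κ > 0. For r > 0 and real numbers p, q, ζ with q < ζ < p < q + 2π, define Z♯(r,p,ζ) := Θ′(r,0)^{6/κ} · Θ(r,p−q)^{2/κ} · Θ(r,p−ζ)^{−4/κ} · Θ(r,ζ−q)^{−4/κ} (real powers of positive real numbers, q being fixed). Then ∂_r Z♯ = (κ/2)·∂_p² Z♯ + H(r,p−q)·∂_p Z♯ + (3/κ − 1/2)·H′(r,p−q)·Z♯ − (6/κ)·(ζ_r(π)/π)·Z♯ + ∂_ζ [ (H(r,p−q) − H(r,p−ζ))·Z♯ ]. -/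
open Complex

/-- The screening integrand
Z♯(r,p,ζ) = Θ′(r,0)^{6/κ} Θ(r,p−q)^{2/κ} Θ(r,p−ζ)^{−4/κ} Θ(r,ζ−q)^{−4/κ}. -/
noncomputable def Zsharp (κ q r p ζ : ℝ) : ℝ :=
  ((deriv (Theta r) 0).re) ^ ((6 : ℝ) / κ) *
  ((Theta r ((p - q : ℝ) : ℂ)).re) ^ ((2 : ℝ) / κ) *
  ((Theta r ((p - ζ : ℝ) : ℂ)).re) ^ (-((4 : ℝ) / κ)) *
  ((Theta r ((ζ - q : ℝ) : ℂ)).re) ^ (-((4 : ℝ) / κ))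


open Filter Topology

namespace NV

/-- n + 1/2 as a real. -/
noncomputable def hf (n : ℤ) : ℝ := (n : ℝ) + 1 / 2

/-- term of the k-th derivative. -/
noncomputable def tm (k : ℕ) (r : ℝ) (z : ℂ) (n : ℤ) : ℂ :=
  (-1 : ℂ) ^ n * (Complex.I * (hf n : ℂ)) ^ k * Complex.exp (-(r : ℂ) * (hf n : ℂ) ^ 2) *
    Complex.exp ((hf n : ℂ) * Complex.I * z)

/-- k-th z-derivative of Theta. -/
noncomputable def TT (k : ℕ) (r : ℝ) (z : ℂ) : ℂ := (1 / Complex.I) * ∑' n : ℤ, tm k r z n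

lemma Theta_eq (r : ℝ) : Theta r = TT 0 r := by
  funext z
  simp [Theta, TT, tm, hf]

/-- the bound -/
noncomputable def bd (k : ℕ) (δ R : ℝ) (n : ℤ) : ℝ :=
  |hf n| ^ k * Real.exp (-δ * hf n ^ 2 + R * |hf n|)

lemma summable_bd (k : ℕ) (δ R : ℝ) (hδ : 0 < δ) : Summable (bd k δ R) := by
  have hs : Summable (fun n : ℤ => Real.exp (-|(n : ℝ)|)) := by
    apply Summable.of_nat_of_neg
    · simpa using Real.summable_exp_neg_nat
    · simpa using Real.summable_exp_neg_nat
  refine Summable.of_nonneg_of_le (fun n => by unfold bd; positivity) (fun n => ?_)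
    (hs.mul_left ((k.factorial : ℝ) * Real.exp ((R + 2) ^ 2 / (4 * δ) + 1)))
  unfold bd
  have h1 : |hf n| ^ k ≤ k.factorial * Real.exp (|hf n|) := by
    have := Real.pow_div_factorial_le_exp (|hf n|) (abs_nonneg _) k
    rw [div_le_iff₀ (by positivity)] at this
    linarith
  have h2 : |(n : ℝ)| ≤ |hf n| + 1 := by
    unfold hf
    have := abs_sub_abs_le_abs_sub (n : ℝ) (n + 1 / 2)
    have h3 : |(n : ℝ) - (n + 1 / 2)| = 1 / 2 := by
      rw [show (n : ℝ) - (n + 1 / 2) = -(1 / 2) by ring, abs_neg]; norm_num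
    linarith
  have h3 : -δ * hf n ^ 2 + (R + 2) * |hf n| ≤ (R + 2) ^ 2 / (4 * δ) := by
    rw [le_div_iff₀ (by positivity), ← sq_abs (hf n)]
    nlinarith [sq_nonneg (2 * δ * |hf n| - (R + 2))]
  calc |hf n| ^ k * Real.exp (-δ * hf n ^ 2 + R * |hf n|)
      ≤ (k.factorial * Real.exp (|hf n|)) * Real.exp (-δ * hf n ^ 2 + R * |hf n|) := by gcongr
    _ = k.factorial * Real.exp (|hf n| + (-δ * hf n ^ 2 + R * |hf n|)) := by
        rw [Real.exp_add (|hf n|)]; ring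
    _ ≤ k.factorial * Real.exp (((R + 2) ^ 2 / (4 * δ) + 1) + -|(n : ℝ)|) := by
        have h4 : |hf n| + (-δ * hf n ^ 2 + R * |hf n|) ≤
            ((R + 2) ^ 2 / (4 * δ) + 1) + -|(n : ℝ)| := by linarith
        have := Real.exp_le_exp.mpr h4
        gcongr
    _ = _ := by rw [Real.exp_add]; ring

lemma norm_tm_le (k : ℕ) (δ R r : ℝ) (z : ℂ) (hr : δ ≤ r) (hz : |z.im| ≤ R) (n : ℤ) :
    ‖tm k r z n‖ ≤ bd k δ R n := by
  unfold tm bd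
  rw [norm_mul, norm_mul, norm_mul, norm_zpow, norm_pow, norm_mul, Complex.norm_exp,
    Complex.norm_exp]
  have e1 : (-(r : ℂ) * (hf n : ℂ) ^ 2).re = -r * hf n ^ 2 := by
    rw [← Complex.ofReal_neg, ← Complex.ofReal_pow, ← Complex.ofReal_mul, Complex.ofReal_re]
  have e2 : ((hf n : ℂ) * Complex.I * z).re = -(hf n * z.im) := by
    simp
  rw [e1, e2, norm_neg, norm_one, one_zpow, one_mul, Complex.norm_I, one_mul, Complex.norm_real,
    Real.norm_eq_abs, mul_assoc, ← Real.exp_add]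
  have h : -(hf n * z.im) ≤ R * |hf n| := by
    calc -(hf n * z.im) ≤ |hf n * z.im| := neg_le_abs _
      _ = |z.im| * |hf n| := by rw [abs_mul, mul_comm]
      _ ≤ _ := by gcongr
  gcongr

lemma summable_tm (k : ℕ) (r : ℝ) (hr : 0 < r) (z : ℂ) : Summable (tm k r z) :=
  Summable.of_norm_bounded (summable_bd k r |z.im| hr)
    (fun n => norm_tm_le k r _ r z le_rfl le_rfl n)

lemma hasDerivAt_TT_z (k : ℕ) (r : ℝ) (hr : 0 < r) (z : ℂ) :
    HasDerivAt (TT k r) (TT (k + 1) r z) z := by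
  unfold TT
  apply HasDerivAt.const_mul
  have hmem : z ∈ Metric.ball z 1 := Metric.mem_ball_self one_pos
  have := hasDerivAt_tsum_of_isPreconnected (𝕜 := ℂ) (F := ℂ) (g := fun n w => tm k r w n)
    (g' := fun n w => tm (k + 1) r w n) (t := Metric.ball z 1) (y₀ := z) (y := z)
    (summable_bd (k + 1) r (|z.im| + 1) hr) Metric.isOpen_ball
    (convex_ball z 1).isPreconnected ?_ ?_ hmem (summable_tm k r hr z) hmem
  · exact this
  · intro n y _
    unfold tm
    have h : HasDerivAt (fun w : ℂ => (hf n : ℂ) * Complex.I * w) ((hf n : ℂ) * Complex.I) y := by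
      simpa using (hasDerivAt_id y).const_mul ((hf n : ℂ) * Complex.I)
    refine ((h.cexp).const_mul ((-1 : ℂ) ^ n * (Complex.I * (hf n : ℂ)) ^ k *
      Complex.exp (-(r : ℂ) * (hf n : ℂ) ^ 2))).congr_deriv ?_
    ring
  · intro n y hy
    apply norm_tm_le _ _ _ _ _ le_rfl
    have : |(y - z).im| ≤ ‖y - z‖ := Complex.abs_im_le_norm _
    rw [Metric.mem_ball, dist_eq_norm] at hy
    have h3 : y.im = z.im + (y - z).im := by simp
    rw [h3]
    exact (abs_add_le _ _).trans (by linarith)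

lemma hasDerivAt_TT_r (k : ℕ) (r : ℝ) (hr : 0 < r) (z : ℂ) :
    HasDerivAt (fun s => TT k s z) (TT (k + 2) r z) r := by
  unfold TT
  apply HasDerivAt.const_mul
  have hmem : r ∈ Metric.ball r (r / 2) := Metric.mem_ball_self (by positivity)
  have := hasDerivAt_tsum_of_isPreconnected (𝕜 := ℝ) (F := ℂ) (g := fun n s => tm k s z n)
    (g' := fun n s => tm (k + 2) s z n) (t := Metric.ball r (r / 2)) (y₀ := r) (y := r)
    (summable_bd (k + 2) (r / 2) (|z.im|) (by positivity)) Metric.isOpen_ball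
    (convex_ball r (r / 2)).isPreconnected ?_ ?_ hmem (summable_tm k r hr z) hmem
  · exact this
  · intro n y _
    unfold tm
    have h : HasDerivAt (fun w : ℝ => -(w : ℂ) * (hf n : ℂ) ^ 2) (-1 * (hf n : ℂ) ^ 2) y :=
      ((Complex.ofRealCLM.hasDerivAt (x := y)).neg).mul_const _
    refine (((h.cexp).const_mul ((-1 : ℂ) ^ n * (Complex.I * (hf n : ℂ)) ^ k)).mul_const
      (Complex.exp ((hf n : ℂ) * Complex.I * z))).congr_deriv ?_
    rw [pow_add, mul_pow Complex.I _ 2, Complex.I_sq]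
    ring
  · intro n y hy
    apply norm_tm_le _ _ _ _ _ _ le_rfl
    rw [Metric.mem_ball, Real.dist_eq, abs_lt] at hy
    linarith

lemma deriv_TT (k : ℕ) (r : ℝ) (hr : 0 < r) : deriv (TT k r) = TT (k + 1) r :=
  funext fun z => (hasDerivAt_TT_z k r hr z).deriv

lemma differentiable_TT (k : ℕ) (r : ℝ) (hr : 0 < r) : Differentiable ℂ (TT k r) :=
  fun z => (hasDerivAt_TT_z k r hr z).differentiableAt

lemma TT_add_two_pi (k : ℕ) (r : ℝ) (z : ℂ) :
    TT k r (z + 2 * Real.pi) = -TT k r z := by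
  unfold TT
  rw [← mul_neg, ← tsum_neg]
  congr 2
  funext n
  unfold tm
  have : Complex.exp ((hf n : ℂ) * Complex.I * (z + 2 * Real.pi)) =
      -Complex.exp ((hf n : ℂ) * Complex.I * z) := by
    rw [show (hf n : ℂ) * Complex.I * (z + 2 * Real.pi) =
      (hf n : ℂ) * Complex.I * z + (n * (2 * Real.pi * Complex.I) + Real.pi * Complex.I) by
        unfold hf; push_cast; ring]
    rw [Complex.exp_add, Complex.exp_add, Complex.exp_int_mul_two_pi_mul_I, Complex.exp_pi_mul_I]
    ring
  rw [this]; ring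

lemma TT_zero_add_ir (r : ℝ) (z : ℂ) :
    TT 0 r (z + 2 * Complex.I * r) = -Complex.exp (r - Complex.I * z) * TT 0 r z := by
  unfold TT
  rw [mul_left_comm]
  congr 1
  rw [← tsum_mul_left, ← (Equiv.addRight (1 : ℤ)).tsum_eq
    (fun n => -Complex.exp (r - Complex.I * z) * tm 0 r z n)]
  apply tsum_congr
  intro n
  have h : (hf (n + 1) : ℂ) = hf n + 1 := by unfold hf; push_cast; ring
  simp only [Equiv.coe_addRight, tm, h, pow_zero, mul_one]
  rw [zpow_add₀ (by norm_num), zpow_one]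
  have e : Complex.exp (-(r : ℂ) * hf n ^ 2) *
      Complex.exp (hf n * Complex.I * (z + 2 * Complex.I * r)) =
      Complex.exp (r - Complex.I * z) * Complex.exp (-(r : ℂ) * (hf n + 1) ^ 2) *
      Complex.exp ((hf n + 1) * Complex.I * z) := by
    rw [← Complex.exp_add, ← Complex.exp_add, ← Complex.exp_add]
    congr 1
    linear_combination (2 * r * hf n : ℂ) * Complex.I_sq
  linear_combination ((-1 : ℂ) ^ n) * e

lemma TT_neg (k : ℕ) (r : ℝ) (z : ℂ) : TT k r (-z) = (-1) ^ (k + 1) * TT k r z := by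
  unfold TT
  rw [mul_left_comm]
  congr 1
  rw [← tsum_mul_left, ← (Equiv.subLeft (-1 : ℤ)).tsum_eq]
  apply tsum_congr
  intro n
  have h : hf (-1 - n) = - hf n := by unfold hf; push_cast; ring
  simp only [Equiv.subLeft_apply, tm, h]
  have h2 : (-1 : ℂ) ^ (-1 - n) = -(-1) ^ n := by
    have h3 : (-1 : ℂ) ^ n * (-1) ^ n = 1 := by rw [← mul_zpow]; norm_num
    rw [zpow_sub₀ (by norm_num), zpow_neg_one, div_eq_iff (zpow_ne_zero _ (by norm_num)),
      show ((-1 : ℂ))⁻¹ = -1 by norm_num]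
    linear_combination h3
  rw [h2]
  push_cast
  rw [mul_neg, neg_pow (Complex.I * (hf n : ℂ)), neg_sq, pow_succ,
    show -(hf n : ℂ) * Complex.I * -z = hf n * Complex.I * z by ring]
  ring

lemma TT_conj (k : ℕ) (r : ℝ) (z : ℂ) :
    (starRingEnd ℂ) (TT k r z) = TT k r ((starRingEnd ℂ) z) := by
  unfold TT
  rw [map_mul, Complex.conj_tsum, map_div₀, map_one, Complex.conj_I,
    show 1 / -Complex.I = 1 / Complex.I * (-1) by ring, mul_assoc, ← tsum_mul_left]
  congr 1
  rw [← (Equiv.subLeft (-1 : ℤ)).tsum_eq]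
  apply tsum_congr
  intro n
  have h : hf (-1 - n) = - hf n := by unfold hf; push_cast; ring
  simp only [Equiv.subLeft_apply, tm, h]
  have h2 : (-1 : ℂ) ^ (-1 - n) = -(-1) ^ n := by
    have h3 : (-1 : ℂ) ^ n * (-1) ^ n = 1 := by rw [← mul_zpow]; norm_num
    rw [zpow_sub₀ (by norm_num), zpow_neg_one, div_eq_iff (zpow_ne_zero _ (by norm_num)),
      show ((-1 : ℂ))⁻¹ = -1 by norm_num]
    linear_combination h3
  rw [h2]
  simp only [map_mul, map_pow, map_neg, ← Complex.exp_conj, Complex.conj_ofReal, Complex.conj_I,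
    map_one, map_zpow₀]
  push_cast
  rw [neg_sq]
  ring_nf

lemma TT_real (k : ℕ) (r : ℝ) (x : ℝ) : ((TT k r x).re : ℂ) = TT k r x := by
  apply Complex.conj_eq_iff_re.mp
  rw [TT_conj, Complex.conj_ofReal]

lemma TT_zero_zero (r : ℝ) : TT 0 r 0 = 0 := by
  have := TT_neg 0 r 0
  simp at this
  linear_combination this / 2

lemma TT_two_zero (r : ℝ) : TT 2 r 0 = 0 := by
  have := TT_neg 2 r 0
  norm_num at this
  linear_combination this / 2

lemma TT_one_pi (r : ℝ) : TT 1 r Real.pi = 0 := by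
  have h1 := TT_neg 1 r Real.pi
  have h2 := TT_add_two_pi 1 r (-Real.pi)
  rw [show -(Real.pi : ℂ) + 2 * Real.pi = Real.pi by ring, h1] at h2
  norm_num at h2
  linear_combination h2 / 2

end NV

namespace NV

/-- The period pair (2π, 2ir). -/
noncomputable def LL (r : ℝ) (hr : 0 < r) : PeriodPair where
  ω₁ := 2 * Real.pi
  ω₂ := 2 * Complex.I * r
  indep := by
    rw [LinearIndependent.pair_iff]
    intro s t h
    have h1 := congrArg Complex.re h
    have h2 := congrArg Complex.im h
    simp at h1 h2
    exact ⟨h1, h2.resolve_right hr.ne'⟩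

/-- The half product. -/
noncomputable def BB (Q : ℝ) (w : ℂ) : ℂ := ∏' n : ℕ, (1 + -((Q : ℂ) ^ (n + 1) * w))

lemma summable_BB (Q : ℝ) (h0 : 0 < Q) (h1 : Q < 1) (w : ℂ) :
    Summable (fun n : ℕ => ‖-((Q : ℂ) ^ (n + 1) * w)‖) := by
  have : Summable (fun n : ℕ => Q ^ (n + 1) * ‖w‖) :=
    ((summable_nat_add_iff 1).mpr (summable_geometric_of_lt_one h0.le h1)).mul_right _
  refine this.congr fun n => ?_
  rw [norm_neg, norm_mul, norm_pow, Complex.norm_real, Real.norm_of_nonneg h0.le]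

lemma BB_mul (Q : ℝ) (h0 : 0 < Q) (h1 : Q < 1) (w : ℂ) :
    BB Q w = (1 - Q * w) * BB Q (Q * w) := by
  unfold BB
  rw [tprod_eq_zero_mul']
  · congr 1
    · ring
    · apply tprod_congr; intro n; ring
  · exact (multipliable_one_add_of_summable (summable_BB Q h0 h1 (Q * w))).congr
      (fun n => by ring)

lemma BB_ne_zero (Q : ℝ) (h0 : 0 < Q) (h1 : Q < 1) (w : ℂ)
    (h : ∀ n : ℕ, (Q : ℂ) ^ (n + 1) * w ≠ 1) : BB Q w ≠ 0 := by
  apply tprod_one_add_ne_zero_of_summable _ (summable_BB Q h0 h1 w)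
  intro n hn
  exact h n (by linear_combination -hn)

lemma differentiable_BB (Q : ℝ) (h0 : 0 < Q) (h1 : Q < 1) : Differentiable ℂ (BB Q) := by
  have hl : HasProdLocallyUniformlyOn (fun (n : ℕ) (w : ℂ) => 1 + -((Q : ℂ) ^ (n + 1) * w))
      (BB Q) Set.univ := by
    apply hasProdLocallyUniformlyOn_of_forall_compact isOpen_univ
    intro K _ hcK
    obtain ⟨C, hC⟩ := hcK.isBounded.exists_norm_le
    have hs : Summable (fun n : ℕ => Q ^ (n + 1) * C) :=
      ((summable_nat_add_iff 1).mpr (summable_geometric_of_lt_one h0.le h1)).mul_right _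
    refine hs.hasProdUniformlyOn_nat_one_add hcK (.of_forall fun n x hx => ?_)
      (fun _ => by fun_prop)
    rw [norm_neg, norm_mul, norm_pow, Complex.norm_real, Real.norm_of_nonneg h0.le]
    have := hC x hx
    gcongr
  have := hl.differentiableOn (.of_forall fun _ => by
    simpa [Finset.prod_fn] using DifferentiableOn.finsetProd (fun _ _ => by fun_prop)) isOpen_univ
  exact differentiableOn_univ.mp this

/-- The product. -/
noncomputable def PP (r : ℝ) (z : ℂ) : ℂ :=
  Complex.sin (z / 2) * (BB (Real.exp (-2 * r)) (Complex.exp (Complex.I * z)) *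
    BB (Real.exp (-2 * r)) (Complex.exp (-(Complex.I * z))))

lemma Q_lt_one (r : ℝ) (hr : 0 < r) : Real.exp (-2 * r) < 1 := by
  rw [Real.exp_lt_one_iff]; linarith

lemma differentiable_PP (r : ℝ) (hr : 0 < r) : Differentiable ℂ (PP r) := by
  have := differentiable_BB _ (Real.exp_pos (-2 * r)) (Q_lt_one r hr)
  unfold PP
  fun_prop

lemma PP_deriv_zero (r : ℝ) (hr : 0 < r) : ∃ c : ℂ, c ≠ 0 ∧ HasDerivAt (PP r) c 0 := by
  have hB := differentiable_BB _ (Real.exp_pos (-2 * r)) (Q_lt_one r hr)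
  have hne : BB (Real.exp (-2 * r)) 1 ≠ 0 := by
    apply BB_ne_zero _ (Real.exp_pos (-2 * r)) (Q_lt_one r hr)
    intro n hn
    have h2 : (Real.exp (-2 * r)) ^ (n + 1) < 1 :=
      pow_lt_one₀ (Real.exp_pos _).le (Q_lt_one r hr) (by simp)
    rw [mul_one] at hn
    have : (Real.exp (-2 * r)) ^ (n + 1) = 1 := by exact_mod_cast hn
    linarith
  have h1 : HasDerivAt (fun z : ℂ => Complex.sin (z / 2)) (1 / 2) 0 := by
    have : HasDerivAt (fun z : ℂ => z / 2) (1 / 2) 0 := (hasDerivAt_id 0).div_const 2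
    simpa using this.csin
  have h2 : DifferentiableAt ℂ (fun z : ℂ => BB (Real.exp (-2 * r)) (Complex.exp (Complex.I * z)) *
    BB (Real.exp (-2 * r)) (Complex.exp (-(Complex.I * z)))) 0 := by fun_prop
  refine ⟨_, ?_, h1.mul h2.hasDerivAt⟩
  simpa using hne

lemma PP_add_two_pi (r : ℝ) (z : ℂ) : PP r (z + 2 * Real.pi) = -PP r z := by
  unfold PP
  rw [show (z + 2 * Real.pi) / 2 = z / 2 + Real.pi by ring, Complex.sin_add_pi,
    show Complex.I * (z + 2 * Real.pi) = Complex.I * z + 2 * Real.pi * Complex.I by ring,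
    Complex.exp_periodic, neg_add, Complex.exp_add _ (-(2 * Real.pi * Complex.I)),
    Complex.exp_neg (2 * Real.pi * Complex.I), Complex.exp_two_pi_mul_I]
  simp

lemma sin_half (z : ℂ) : Complex.sin (z / 2) =
    Complex.exp (Complex.I * z / 2) * (1 - Complex.exp (-(Complex.I * z))) / (2 * Complex.I) := by
  rw [Complex.sin, mul_sub, ← Complex.exp_add,
    show Complex.I * z / 2 + -(Complex.I * z) = -(z / 2) * Complex.I by ring,
    show Complex.I * z / 2 = z / 2 * Complex.I by ring]
  field_simp
  rw [Complex.I_sq]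
  ring

lemma PP_add_ir (r : ℝ) (hr : 0 < r) (z : ℂ) :
    PP r (z + 2 * Complex.I * r) = -Complex.exp (r - Complex.I * z) * PP r z := by
  have h0 := Real.exp_pos (-2 * r)
  have h1 := Q_lt_one r hr
  have hb1 := BB_mul _ h0 h1 (Complex.exp (Complex.I * z))
  have hb2 := BB_mul _ h0 h1 (Complex.exp (-(Complex.I * (z + 2 * Complex.I * r))))
  have e1 : (Real.exp (-2 * r) : ℂ) * Complex.exp (Complex.I * z) =
      Complex.exp (Complex.I * (z + 2 * Complex.I * r)) := by
    rw [Complex.ofReal_exp, ← Complex.exp_add]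
    congr 1
    push_cast
    linear_combination (-2 * r : ℂ) * Complex.I_sq
  have e2 : (Real.exp (-2 * r) : ℂ) * Complex.exp (-(Complex.I * (z + 2 * Complex.I * r))) =
      Complex.exp (-(Complex.I * z)) := by
    rw [Complex.ofReal_exp, ← Complex.exp_add]
    congr 1
    push_cast
    linear_combination (-2 * r : ℂ) * Complex.I_sq
  rw [e1] at hb1
  rw [e2] at hb2
  unfold PP
  rw [hb1, hb2, sin_half, sin_half z]
  set X := BB (Real.exp (-2 * r)) (Complex.exp (Complex.I * (z + 2 * Complex.I * r)))
  set Y := BB (Real.exp (-2 * r)) (Complex.exp (-(Complex.I * z)))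
  have e3 : Complex.exp (Complex.I * (z + 2 * Complex.I * r) / 2) =
      Complex.exp (Complex.I * z / 2) * Complex.exp (-r) := by
    rw [← Complex.exp_add]
    congr 1
    linear_combination (r : ℂ) * Complex.I_sq
  have e4 : Complex.exp (-r) * (1 - Complex.exp (-(Complex.I * (z + 2 * Complex.I * r)))) =
     - Complex.exp (r - Complex.I * z) *
      (1 - Complex.exp (Complex.I * (z + 2 * Complex.I * r))) := by
    rw [mul_sub, mul_sub, ← Complex.exp_add, neg_mul, neg_mul, ← Complex.exp_add]
    rw [show -(r : ℂ) + -(Complex.I * (z + 2 * Complex.I * r)) = r - Complex.I * z by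
        linear_combination (-2 * r : ℂ) * Complex.I_sq,
      show (r : ℂ) - Complex.I * z + Complex.I * (z + 2 * Complex.I * r) = -r by
        linear_combination (2 * r : ℂ) * Complex.I_sq]
    ring
  rw [e3]
  linear_combination (Complex.exp (Complex.I * z / 2) * X * Y *
    (1 - Complex.exp (-(Complex.I * z))) / (2 * Complex.I)) * e4

lemma PP_zero (r : ℝ) (hr : 0 < r) (z : ℂ) (h : PP r z = 0) : z ∈ (LL r hr).lattice := by
  have h0 := Real.exp_pos (-2 * r)
  have h1 := Q_lt_one r hr
  rw [PeriodPair.mem_lattice]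
  simp only [LL]
  have key : ∀ w : ℂ, BB (Real.exp (-2 * r)) (Complex.exp (Complex.I * w)) = 0 →
      ∃ m n : ℤ, m * (2 * (Real.pi : ℂ)) + n * (2 * Complex.I * r) = w := by
    intro w hw
    by_contra hcon
    refine BB_ne_zero _ h0 h1 _ ?_ hw
    intro n hn
    rw [Complex.ofReal_exp, ← Complex.exp_nat_mul, ← Complex.exp_add, Complex.exp_eq_one_iff] at hn
    obtain ⟨m, hm⟩ := hn
    apply hcon
    refine ⟨m, -(n + 1), ?_⟩
    push_cast at hm ⊢
    linear_combination Complex.I * hm + (-w + m * 2 * Real.pi) * Complex.I_sq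
  unfold PP at h
  rcases mul_eq_zero.mp h with h | h
  · rw [Complex.sin_eq_zero_iff] at h
    obtain ⟨k, hk⟩ := h
    exact ⟨k, 0, by push_cast; linear_combination -2 * hk⟩
  · rcases mul_eq_zero.mp h with h | h
    · exact key z h
    · rw [show -(Complex.I * z) = Complex.I * (-z) by ring] at h
      obtain ⟨m, n, hmn⟩ := key _ h
      exact ⟨-m, -n, by push_cast; linear_combination -hmn⟩

lemma elliptic_const (L : PeriodPair) (f : ℂ → ℂ) (S : Set ℂ)
    (hS : ∀ z, ∀ᶠ w in 𝓝[≠] z, w ∉ S)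
    (hd : ∀ z, z ∉ S → DifferentiableAt ℂ f z)
    (hp : ∀ l ∈ L.lattice, ∀ z, z ∉ S → f (z + l) = f z)
    (hl : ∀ z ∈ S, ∃ l ∈ L.lattice, ∃ c, Tendsto f (𝓝[≠] (z + l)) (𝓝 c)) :
    ∃ C, ∀ z, z ∉ S → f z = C := by
  have shift : ∀ z l : ℂ, Tendsto (fun w => w + l) (𝓝[≠] z) (𝓝[≠] (z + l)) := by
    intro z l
    apply tendsto_nhdsWithin_iff.mpr
    refine ⟨?_, ?_⟩
    · exact ((continuous_id.add continuous_const).tendsto z).mono_left nhdsWithin_le_nhds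
    · filter_upwards [self_mem_nhdsWithin] with w hw
      simpa using hw
  have hex : ∀ z, ∃ c, Tendsto f (𝓝[≠] z) (𝓝 c) := by
    intro z
    by_cases hz : z ∈ S
    · obtain ⟨l, hl, c, hc⟩ := hl z hz
      refine ⟨c, (hc.comp (shift z l)).congr' ?_⟩
      filter_upwards [hS z] with w hw
      exact hp l hl w hw
    · exact ⟨f z, (hd z hz).continuousAt.tendsto.mono_left nhdsWithin_le_nhds⟩
  choose g hg using hex
  have hgf : ∀ z, z ∉ S → g z = f z := fun z hz =>
    tendsto_nhds_unique (hg z) ((hd z hz).continuousAt.tendsto.mono_left nhdsWithin_le_nhds)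
  have hgd : Differentiable ℂ g := by
    intro z
    apply AnalyticAt.differentiableAt
    apply Complex.analyticAt_of_differentiable_on_punctured_nhds_of_continuousAt
    · filter_upwards [hS z] with w hw
      have : g =ᶠ[𝓝 w] f := by
        have h := hS w
        rw [eventually_nhdsWithin_iff] at h
        filter_upwards [h] with y hy
        apply hgf
        by_cases hyw : y = w
        · rwa [hyw]
        · exact hy hyw
      exact (hd w hw).congr_of_eventuallyEq this
    · rw [continuousAt_iff_punctured_nhds]
      apply (hg z).congr'
      filter_upwards [hS z] with w hw
      exact (hgf w hw).symm
  have hgp : ∀ l ∈ L.lattice, ∀ z, g (z + l) = g z := by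
    intro l hl z
    refine tendsto_nhds_unique ((hg (z + l)).comp (shift z l)) ((hg z).congr' ?_)
    filter_upwards [hS z] with w hw
    exact (hp l hl w hw).symm
  have hb : Bornology.IsBounded (Set.range g) := by
    have hcomp : IsCompact (closure (ZSpan.fundamentalDomain L.basis)) :=
      (ZSpan.fundamentalDomain_isBounded L.basis).isCompact_closure
    refine (hcomp.image hgd.continuous).isBounded.subset ?_
    rintro _ ⟨z, rfl⟩
    refine ⟨ZSpan.fract L.basis z, subset_closure (ZSpan.fract_mem_fundamentalDomain _ _), ?_⟩
    have hm : ((ZSpan.floor L.basis z : Submodule.span ℤ (Set.range L.basis)) : ℂ) ∈ L.lattice := by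
      rw [PeriodPair.lattice_eq_span_range_basis]
      exact (ZSpan.floor L.basis z).2
    rw [← hgp _ hm, ZSpan.fract_apply, sub_add_cancel]
  refine ⟨g 0, fun z hz => ?_⟩
  rw [← hgf z hz]
  exact hgd.apply_eq_apply_of_bounded hb z 0

end NV

namespace NV

lemma per_ext (L : PeriodPair) (f : ℂ → ℂ) (S : Set ℂ)
    (hS : ∀ l ∈ L.lattice, ∀ z, z ∉ S → z + l ∉ S)
    (h1 : ∀ z, z ∉ S → f (z + L.ω₁) = f z) (h2 : ∀ z, z ∉ S → f (z + L.ω₂) = f z) :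
    ∀ l ∈ L.lattice, ∀ z, z ∉ S → f (z + l) = f z := by
  let A : AddSubgroup ℂ :=
    { carrier := {l | l ∈ L.lattice ∧ ∀ z, z ∉ S → f (z + l) = f z}
      zero_mem' := ⟨L.lattice.zero_mem, fun z _ => by rw [add_zero]⟩
      add_mem' := by
        rintro a b ⟨ha, ha'⟩ ⟨hb, hb'⟩
        refine ⟨add_mem ha hb, fun z hz => ?_⟩
        rw [← add_assoc, hb' _ (hS a ha z hz), ha' z hz]
      neg_mem' := by
        rintro a ⟨ha, ha'⟩
        refine ⟨neg_mem ha, fun z hz => ?_⟩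
        have := ha' (z + -a) (hS _ (neg_mem ha) z hz)
        rw [← this]
        congr 1
        ring }
  have hle : L.lattice ≤ AddSubgroup.toIntSubmodule A := by
    unfold PeriodPair.lattice
    rw [Submodule.span_le]
    rintro x (rfl | rfl)
    · exact ⟨L.ω₁_mem_lattice, h1⟩
    · exact ⟨L.ω₂_mem_lattice, h2⟩
  intro l hl
  exact (hle hl).2

lemma lat_disc (L : PeriodPair) (z : ℂ) : ∀ᶠ w in 𝓝[≠] z, w ∉ L.lattice := by
  rw [eventually_nhdsWithin_iff]
  filter_upwards [L.compl_lattice_sdiff_singleton_mem_nhds z] with w hw hne hwl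
  exact hw ⟨hwl, hne⟩

lemma lat_shift (L : PeriodPair) : ∀ l ∈ L.lattice, ∀ z, z ∉ (L.lattice : Set ℂ) →
    z + l ∉ (L.lattice : Set ℂ) := by
  intro l hl z hz h
  apply hz
  have := sub_mem h hl
  simpa using this

lemma TT_ne (r : ℝ) (hr : 0 < r) (S : Set ℂ) (hS : ∀ z, ∀ᶠ w in 𝓝[≠] z, w ∉ S) :
    ∃ z, z ∉ S ∧ TT 0 r z ≠ 0 := by
  by_contra hcon
  push Not at hcon
  have hz : ∀ z, TT 0 r z = 0 := by
    intro z
    have hc := (differentiable_TT 0 r hr z).continuousAt.tendsto.mono_left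
      (nhdsWithin_le_nhds (s := {z}ᶜ))
    refine tendsto_nhds_unique hc (tendsto_const_nhds.congr' ?_)
    filter_upwards [hS z] with w hw
    exact (hcon w hw).symm
  -- Fourier coefficient
  let c : ℤ → ℂ := fun n => (-1 : ℂ) ^ n * Complex.exp (-(r : ℂ) * (hf n : ℂ) ^ 2)
  let g : ℤ → C(ℝ, ℂ) := fun n =>
    ⟨fun x => c n * Complex.exp (n * Complex.I * x), by fun_prop⟩
  have hnorm : ∀ (n : ℤ) (x : ℝ), ‖g n x‖ = ‖tm 0 r 0 n‖ := by
    intro n x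
    simp only [g, c, tm, ContinuousMap.coe_mk, norm_mul, Complex.norm_exp]
    simp
  have hsum : Summable fun n => ‖(g n).restrict
      (⟨Set.uIcc (0 : ℝ) (2 * Real.pi), isCompact_uIcc⟩ : TopologicalSpace.Compacts ℝ)‖ := by
    refine Summable.of_nonneg_of_le (fun n => norm_nonneg _) (fun n => ?_)
      (summable_tm 0 r hr 0).norm
    refine (ContinuousMap.norm_le _ (norm_nonneg _)).mpr fun x => ?_
    exact (hnorm n x).le
  have hI := intervalIntegral.hasSum_intervalIntegral_of_summable_norm hsum
  have h0 : ∀ x : ℝ, ∑' n, g n x = 0 := by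
    intro x
    have h := hz x
    unfold TT at h
    have h' := (mul_eq_zero.mp h).resolve_left (by simp)
    have : ∀ n, g n x = Complex.exp (-(Complex.I * x / 2)) * tm 0 r x n := by
      intro n
      simp only [g, c, tm, ContinuousMap.coe_mk, pow_zero, mul_one]
      rw [show (n : ℂ) * Complex.I * x = -(Complex.I * x / 2) + (hf n : ℂ) * Complex.I * x by
        unfold hf; push_cast; ring, Complex.exp_add]
      ring
    simp_rw [this]
    rw [tsum_mul_left, h', mul_zero]
  simp_rw [h0] at hI
  have hterm : ∀ n : ℤ, n ≠ 0 → ∫ x in (0 : ℝ)..(2 * Real.pi), g n x = 0 := by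
    intro n hn
    simp only [g, ContinuousMap.coe_mk]
    rw [intervalIntegral.integral_const_mul, integral_exp_mul_complex (by simp [hn])]
    have : (n : ℂ) * Complex.I * ((2 * Real.pi : ℝ) : ℂ) = n * (2 * Real.pi * Complex.I) := by
      push_cast; ring
    rw [this, Complex.exp_int_mul_two_pi_mul_I]
    simp
  have h1 := hasSum_single (f := fun n => ∫ x in (0 : ℝ)..(2 * Real.pi), g n x) 0
    (fun n hn => hterm n hn)
  have h2 := hI.unique h1
  simp [g, c, Complex.exp_ne_zero, Real.pi_ne_zero] at h2

lemma slope_lim (f : ℂ → ℂ) (f' : ℂ) (h : HasDerivAt f f' 0) (h0 : f 0 = 0) :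
    Tendsto (fun z => f z / z) (𝓝[≠] 0) (𝓝 f') := by
  have := hasDerivAt_iff_tendsto_slope_zero.mp h
  refine this.congr fun t => ?_
  simp [h0, div_eq_inv_mul]

lemma PP_zero_zero (r : ℝ) : PP r 0 = 0 := by simp [PP]

lemma theta_struct (r : ℝ) (hr : 0 < r) :
    (∀ z, z ∉ (LL r hr).lattice → TT 0 r z ≠ 0) ∧ TT 1 r 0 ≠ 0 := by
  set L := LL r hr with hL
  obtain ⟨c, hc, hPd⟩ := PP_deriv_zero r hr
  have hlim : Tendsto (fun z => TT 0 r z / PP r z) (𝓝[≠] 0) (𝓝 (TT 1 r 0 / c)) := by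
    refine ((slope_lim _ _ (hasDerivAt_TT_z 0 r hr 0) (TT_zero_zero r)).div
      (slope_lim _ _ hPd (PP_zero_zero r)) hc).congr' ?_
    filter_upwards [self_mem_nhdsWithin] with z hz
    exact div_div_div_cancel_right₀ hz _ _
  have hPne : ∀ z, z ∉ L.lattice → PP r z ≠ 0 := fun z hz h => hz (PP_zero r hr z h)
  obtain ⟨C, hC⟩ := elliptic_const L (fun z => TT 0 r z / PP r z) L.lattice (lat_disc L)
    (fun z hz => (differentiable_TT 0 r hr z).div (differentiable_PP r hr z) (hPne z hz))
    (per_ext L (fun z => TT 0 r z / PP r z) _ (lat_shift L)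
      (fun z _ => by
        show TT 0 r (z + 2 * Real.pi) / PP r (z + 2 * Real.pi) = _
        rw [TT_add_two_pi, PP_add_two_pi, neg_div_neg_eq])
      (fun z _ => by
        show TT 0 r (z + 2 * Complex.I * r) / PP r (z + 2 * Complex.I * r) = _
        rw [TT_zero_add_ir, PP_add_ir r hr]
        rw [mul_div_mul_left _ _ (neg_ne_zero.mpr (Complex.exp_ne_zero _))]))
    (fun z hz => ⟨-z, neg_mem hz, TT 1 r 0 / c, by simpa using hlim⟩)
  have hC0 : C ≠ 0 := by
    obtain ⟨z, hz, hne⟩ := TT_ne r hr L.lattice (lat_disc L)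
    rw [← hC z hz]
    exact div_ne_zero hne (hPne z hz)
  refine ⟨fun z hz h => ?_, fun h => ?_⟩
  · have := hC z hz
    simp only [h, zero_div] at this
    exact hC0 this.symm
  · apply hC0
    rw [h, zero_div] at hlim
    refine tendsto_nhds_unique (tendsto_const_nhds.congr' ?_) hlim
    filter_upwards [lat_disc L 0] with z hz
    exact (hC z hz).symm

/-- log derivative of theta -/
noncomputable def FF (r : ℝ) (z : ℂ) : ℂ := TT 1 r z / TT 0 r z
/-- its derivative -/
noncomputable def DF (r : ℝ) (z : ℂ) : ℂ := TT 2 r z / TT 0 r z - FF r z ^ 2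

lemma hasDerivAt_FF (r : ℝ) (hr : 0 < r) (z : ℂ) (hz : TT 0 r z ≠ 0) :
    HasDerivAt (FF r) (DF r z) z := by
  refine ((hasDerivAt_TT_z 1 r hr z).div (hasDerivAt_TT_z 0 r hr z) hz).congr_deriv ?_
  unfold DF FF
  field_simp

lemma differentiableAt_DF (r : ℝ) (hr : 0 < r) (z : ℂ) (hz : TT 0 r z ≠ 0) :
    DifferentiableAt ℂ (DF r) z :=
  ((differentiable_TT 2 r hr z).div (differentiable_TT 0 r hr z) hz).sub
    ((hasDerivAt_FF r hr z hz).differentiableAt.pow 2)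

lemma FF_neg (r : ℝ) (z : ℂ) : FF r (-z) = -FF r z := by
  unfold FF
  rw [TT_neg, TT_neg]
  norm_num
  rw [div_neg]

lemma DF_neg (r : ℝ) (z : ℂ) : DF r (-z) = DF r z := by
  unfold DF
  rw [FF_neg, TT_neg, TT_neg]
  norm_num

lemma FF_add_two_pi (r : ℝ) (z : ℂ) : FF r (z + 2 * Real.pi) = FF r z := by
  unfold FF
  rw [TT_add_two_pi, TT_add_two_pi, neg_div_neg_eq]

lemma DF_add_two_pi (r : ℝ) (z : ℂ) : DF r (z + 2 * Real.pi) = DF r z := by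
  unfold DF
  rw [TT_add_two_pi, TT_add_two_pi, neg_div_neg_eq, FF_add_two_pi]

lemma hasDerivAt_E (r : ℝ) (z : ℂ) : HasDerivAt (fun z : ℂ => -Complex.exp (r - Complex.I * z))
    (Complex.I * Complex.exp (r - Complex.I * z)) z := by
  have h : HasDerivAt (fun z : ℂ => (r : ℂ) - Complex.I * z) (-(Complex.I * 1)) z :=
    ((hasDerivAt_id z).const_mul Complex.I).const_sub (r : ℂ)
  refine h.cexp.neg.congr_deriv ?_
  ring

lemma TT_one_add_ir (r : ℝ) (hr : 0 < r) (z : ℂ) :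
    TT 1 r (z + 2 * Complex.I * r) =
      -Complex.exp (r - Complex.I * z) * (TT 1 r z - Complex.I * TT 0 r z) := by
  have h1 : HasDerivAt (fun z => TT 0 r (z + 2 * Complex.I * r))
      (TT 1 r (z + 2 * Complex.I * r)) z :=
    (hasDerivAt_TT_z 0 r hr (z + 2 * Complex.I * r)).comp_add_const z _
  have h2 := (hasDerivAt_E r z).mul (hasDerivAt_TT_z 0 r hr z)
  have h3 : (fun z => TT 0 r (z + 2 * Complex.I * r)) =
      (fun z : ℂ => -Complex.exp (r - Complex.I * z)) * TT 0 r := by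
    funext z; exact TT_zero_add_ir r z
  rw [h3] at h1
  rw [h1.unique h2]
  ring

lemma TT_two_add_ir (r : ℝ) (hr : 0 < r) (z : ℂ) :
    TT 2 r (z + 2 * Complex.I * r) =
      -Complex.exp (r - Complex.I * z) *
        (TT 2 r z - 2 * Complex.I * TT 1 r z - TT 0 r z) := by
  have h1 : HasDerivAt (fun z => TT 1 r (z + 2 * Complex.I * r))
      (TT 2 r (z + 2 * Complex.I * r)) z :=
    (hasDerivAt_TT_z 1 r hr (z + 2 * Complex.I * r)).comp_add_const z _
  have h2 := (hasDerivAt_E r z).mul ((hasDerivAt_TT_z 1 r hr z).sub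
    ((hasDerivAt_TT_z 0 r hr z).const_mul Complex.I))
  have h3 : (fun z => TT 1 r (z + 2 * Complex.I * r)) =
      (fun z : ℂ => -Complex.exp (r - Complex.I * z)) *
        (TT 1 r - fun y => Complex.I * TT 0 r y) := by
    funext z; exact TT_one_add_ir r hr z
  rw [h3] at h1
  rw [h1.unique h2]
  simp only [Pi.sub_apply]
  linear_combination (-Complex.exp (r - Complex.I * z) * TT 0 r z) * Complex.I_sq

lemma FF_add_ir (r : ℝ) (hr : 0 < r) (z : ℂ) (hz : TT 0 r z ≠ 0) :
    FF r (z + 2 * Complex.I * r) = FF r z - Complex.I := by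
  unfold FF
  rw [TT_one_add_ir r hr, TT_zero_add_ir,
    mul_div_mul_left _ _ (neg_ne_zero.mpr (Complex.exp_ne_zero _))]
  field_simp

lemma DF_add_ir (r : ℝ) (hr : 0 < r) (z : ℂ) (hz : TT 0 r z ≠ 0) :
    DF r (z + 2 * Complex.I * r) = DF r z := by
  unfold DF
  rw [FF_add_ir r hr z hz, TT_two_add_ir r hr, TT_zero_add_ir,
    mul_div_mul_left _ _ (neg_ne_zero.mpr (Complex.exp_ne_zero _))]
  unfold FF
  field_simp
  linear_combination (-TT 0 r z ^ 2) * Complex.I_sq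

/-- the elliptic combination -/
noncomputable def EE (r : ℝ) (v u : ℂ) : ℂ :=
  (FF r (u + v) - FF r u - FF r v) ^ 2 + (DF r (u + v) + DF r u + DF r v)

lemma EE_lim (r : ℝ) (hr : 0 < r) (v : ℂ) (hv : v ∉ (LL r hr).lattice) :
    Tendsto (EE r v) (𝓝[≠] 0) (𝓝 (TT 3 r 0 / TT 1 r 0)) := by
  obtain ⟨hne, h1⟩ := theta_struct r hr
  have hFd : HasDerivAt (fun u => FF r (u + v) - FF r v) (DF r v) 0 := by
    have : HasDerivAt (FF r) (DF r v) (0 + v) := by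
      rw [zero_add]; exact hasDerivAt_FF r hr v (hne v hv)
    exact (this.comp_add_const 0 v).sub_const _
  have a1 := slope_lim _ _ hFd (by simp)
  have a0 : Tendsto (fun u => FF r (u + v) - FF r v) (𝓝[≠] 0) (𝓝 0) := by
    have := hFd.continuousAt.tendsto.mono_left (nhdsWithin_le_nhds (s := {(0 : ℂ)}ᶜ))
    simpa using this
  have t0 := slope_lim _ _ (hasDerivAt_TT_z 0 r hr 0) (TT_zero_zero r)
  have t2 := slope_lim _ _ (hasDerivAt_TT_z 2 r hr 0) (TT_two_zero r)
  have t1 := (differentiable_TT 1 r hr 0).continuousAt.tendsto.mono_left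
    (nhdsWithin_le_nhds (s := {(0 : ℂ)}ᶜ))
  have d0 : Tendsto (fun u => DF r (u + v)) (𝓝[≠] 0) (𝓝 (DF r v)) := by
    have h : ContinuousAt (DF r) (0 + v) := by
      rw [zero_add]; exact (differentiableAt_DF r hr v (hne v hv)).continuousAt
    have h' : ContinuousAt (fun u => DF r (u + v)) 0 :=
      ContinuousAt.comp (f := fun u : ℂ => u + v) h (by fun_prop)
    have := h'.tendsto.mono_left (nhdsWithin_le_nhds (s := {(0 : ℂ)}ᶜ))
    simpa using this
  have main := ((((a0.pow 2).sub ((a1.mul (t1.div t0 h1)).const_mul 2)).add (t2.div t0 h1)).add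
    d0).add_const (DF r v)
  have e : (0 : ℂ) ^ 2 - 2 * (DF r v * (TT 1 r 0 / TT (0 + 1) r 0)) + TT (2 + 1) r 0 /
      TT (0 + 1) r 0 + DF r v + DF r v = TT 3 r 0 / TT 1 r 0 := by
    norm_num
    rw [div_self h1]; ring
  rw [e] at main
  refine main.congr' ?_
  filter_upwards [self_mem_nhdsWithin, lat_disc (LL r hr) 0] with u hu hul
  have hu' : u ≠ 0 := hu
  have := hne u hul
  simp only [EE, Pi.div_apply]
  have e1 : TT 1 r u / (TT 0 r u / u) = u * FF r u := by
    unfold FF; field_simp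
  have e2 : TT 2 r u / u / (TT 0 r u / u) = DF r u + FF r u ^ 2 := by
    unfold DF; field_simp; ring
  rw [e1, e2]
  field_simp
  ring

lemma EE_symm (r : ℝ) (v u : ℂ) : EE r v (-v - u) = EE r v u := by
  unfold EE
  rw [show -v - u + v = -u by ring, show -v - u = -(u + v) by ring, FF_neg, FF_neg, DF_neg, DF_neg]
  ring

lemma EE_const (r : ℝ) (hr : 0 < r) (v u : ℂ) (hv : v ∉ (LL r hr).lattice)
    (hu : u ∉ (LL r hr).lattice) (huv : u + v ∉ (LL r hr).lattice) :
    EE r v u = TT 3 r 0 / TT 1 r 0 := by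
  obtain ⟨hne, h1⟩ := theta_struct r hr
  set L := LL r hr with hL
  set S : Set ℂ := {u | u ∈ L.lattice ∨ u + v ∈ L.lattice} with hS
  have hlim := EE_lim r hr v hv
  have hlim2 : Tendsto (EE r v) (𝓝[≠] (-v)) (𝓝 (TT 3 r 0 / TT 1 r 0)) := by
    have hm : Tendsto (fun w => -v - w) (𝓝[≠] (-v)) (𝓝[≠] 0) := by
      apply tendsto_nhdsWithin_iff.mpr
      refine ⟨?_, ?_⟩
      · have : ContinuousAt (fun w => -v - w) (-v) := by fun_prop
        have := this.tendsto.mono_left (nhdsWithin_le_nhds (s := {-v}ᶜ))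
        simpa using this
      · filter_upwards [self_mem_nhdsWithin] with w hw h
        apply hw
        simp only [Set.mem_singleton_iff] at h ⊢
        linear_combination -h
    refine (hlim.comp hm).congr fun w => ?_
    exact EE_symm r v w
  have hSd : ∀ z, ∀ᶠ w in 𝓝[≠] z, w ∉ S := by
    intro z
    have hm : Tendsto (fun w => w + v) (𝓝[≠] z) (𝓝[≠] (z + v)) := by
      apply tendsto_nhdsWithin_iff.mpr
      refine ⟨?_, ?_⟩
      · exact ((continuous_id.add continuous_const).tendsto z).mono_left nhdsWithin_le_nhds
      · filter_upwards [self_mem_nhdsWithin] with w hw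
        simpa using hw
    filter_upwards [lat_disc L z, hm.eventually (lat_disc L (z + v))] with w h1 h2 h
    exact h.elim h1 h2
  have hSs : ∀ l ∈ L.lattice, ∀ z, z ∉ S → z + l ∉ S := by
    intro l hl z hz h
    apply hz
    rcases h with h | h
    · left; simpa using sub_mem h hl
    · right
      have := sub_mem h hl
      rwa [show z + l + v - l = z + v by ring] at this
  have hz1 : ∀ z, z ∉ S → TT 0 r z ≠ 0 := fun z hz => hne z fun h => hz (Or.inl h)
  have hz2 : ∀ z, z ∉ S → TT 0 r (z + v) ≠ 0 := fun z hz => hne _ fun h => hz (Or.inr h)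
  obtain ⟨C, hC⟩ := elliptic_const L (EE r v) S hSd
    (fun z hz => by
      have f1 := (hasDerivAt_FF r hr _ (hz1 z hz)).differentiableAt
      have f2 := ((hasDerivAt_FF r hr _ (hz2 z hz)).comp_add_const z v).differentiableAt
      have f3 := differentiableAt_DF r hr _ (hz1 z hz)
      have f4 : DifferentiableAt ℂ (fun u => DF r (u + v)) z :=
        ((differentiableAt_DF r hr _ (hz2 z hz)).hasDerivAt.comp_add_const z v).differentiableAt
      unfold EE
      fun_prop)
    (per_ext L _ _ hSs
      (fun z _ => by
        show EE r v (z + 2 * Real.pi) = EE r v z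
        unfold EE
        rw [show z + 2 * Real.pi + v = (z + v) + 2 * Real.pi by ring, FF_add_two_pi,
          FF_add_two_pi, DF_add_two_pi, DF_add_two_pi])
      (fun z hz => by
        show EE r v (z + 2 * Complex.I * r) = EE r v z
        unfold EE
        rw [show z + 2 * Complex.I * r + v = (z + v) + 2 * Complex.I * r by ring,
          FF_add_ir r hr _ (hz1 z hz), FF_add_ir r hr _ (hz2 z hz), DF_add_ir r hr _ (hz1 z hz),
          DF_add_ir r hr _ (hz2 z hz)]
        ring))
    (fun z hz => by
      rcases hz with hz | hz
      · exact ⟨-z, neg_mem hz, _, by simpa using hlim⟩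
      · exact ⟨-(z + v), neg_mem hz, _, by simpa using hlim2⟩)
  rw [hC u (by rintro (h | h); exacts [hu h, huv h])]
  refine tendsto_nhds_unique (tendsto_const_nhds.congr' ?_) hlim
  filter_upwards [hSd 0] with z hz
  exact (hC z hz).symm

end NV

namespace NV

/-- regular part of zeta, sum over the lattice -/
noncomputable def Wr (r : ℝ) (hr : 0 < r) (z : ℂ) : ℂ :=
  ∑' l : (LL r hr).lattice, if (l : ℂ) = 0 then 0 else (1 / (z - l) + 1 / (l : ℂ) + z / (l : ℂ) ^ 2)

lemma wzeta_eq (r : ℝ) (hr : 0 < r) (z : ℂ) : wzeta r z = 1 / z + Wr r hr z := by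
  unfold wzeta Wr
  congr 1
  rw [← (LL r hr).latticeEquivProd.symm.toEquiv.tsum_eq]
  apply tsum_congr
  intro p
  have h : (((LL r hr).latticeEquivProd.symm.toEquiv p : (LL r hr).lattice) : ℂ) = latPt r p := by
    have := (LL r hr).latticeEquiv_symm_apply p
    refine this.trans ?_
    simp only [LL, latPt]
    ring
  have h0 : (((LL r hr).latticeEquivProd.symm.toEquiv p : (LL r hr).lattice) : ℂ) = 0 ↔ p = 0 := by
    rw [ZeroMemClass.coe_eq_zero]
    exact (LL r hr).latticeEquivProd.symm.map_eq_zero_iff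
  by_cases hp : p = 0
  · rw [if_pos hp, if_pos (h0.mpr hp)]
  · rw [if_neg hp, if_neg (fun hh => hp (h0.mp hh)), h]

lemma Wr_neg (r : ℝ) (hr : 0 < r) (z : ℂ) : Wr r hr (-z) = -Wr r hr z := by
  unfold Wr
  rw [← tsum_neg, ← (Equiv.neg (LL r hr).lattice).tsum_eq]
  apply tsum_congr
  intro l
  simp only [Equiv.neg_apply, NegMemClass.coe_neg, neg_eq_zero]
  split_ifs
  · simp
  · rw [show -z - -(l : ℂ) = -(z - l) by ring, div_neg, div_neg]
    ring

/-- convex domain -/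
def UU (r : ℝ) : Set ℂ := {z | z.re ∈ Set.Ioo (-(3 * Real.pi / 2)) (3 * Real.pi / 2) ∧
  z.im ∈ Set.Ioo (-r) r}

lemma UU_open (r : ℝ) : IsOpen (UU r) :=
  (isOpen_Ioo.preimage Complex.continuous_re).inter (isOpen_Ioo.preimage Complex.continuous_im)

lemma UU_convex (r : ℝ) : Convex ℝ (UU r) :=
  ((convex_Ioo _ _).linear_preimage Complex.reLm).inter
    ((convex_Ioo _ _).linear_preimage Complex.imLm)

lemma UU_zero (r : ℝ) (hr : 0 < r) : (0 : ℂ) ∈ UU r := by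
  have := Real.pi_pos
  simp only [UU, Set.mem_ofPred_eq, Complex.zero_re, Complex.zero_im, Set.mem_Ioo]
  refine ⟨⟨?_, ?_⟩, ?_, ?_⟩ <;> linarith

lemma UU_dist (r : ℝ) (hr : 0 < r) (z : ℂ) (hz : z ∈ UU r) (l : ℂ) (hl : l ∈ (LL r hr).lattice)
    (hl0 : l ≠ 0) : min (Real.pi / 2) r ≤ ‖z - l‖ := by
  obtain ⟨m, n, rfl⟩ := PeriodPair.mem_lattice.mp hl
  simp only [LL] at hl0 ⊢
  obtain ⟨⟨a1, a2⟩, b1, b2⟩ := hz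
  have hpi := Real.pi_pos
  by_cases hn : n = 0
  · have hm : m ≠ 0 := by rintro rfl; simp [hn] at hl0
    refine (min_le_left _ _).trans (le_trans ?_ (Complex.abs_re_le_norm _))
    simp [hn]
    rcases lt_or_gt_of_ne hm with h | h
    · have : (m : ℝ) ≤ -1 := by exact_mod_cast (by omega : m ≤ -1)
      exact le_trans (by nlinarith) (le_abs_self _)
    · have : (1 : ℝ) ≤ m := by exact_mod_cast h
      exact le_trans (by nlinarith) (neg_le_abs _)
  · refine (min_le_right _ _).trans (le_trans ?_ (Complex.abs_im_le_norm _))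
    simp
    rcases lt_or_gt_of_ne hn with h | h
    · have : (n : ℝ) ≤ -1 := by exact_mod_cast (by omega : n ≤ -1)
      exact le_trans (by nlinarith) (le_abs_self _)
    · have : (1 : ℝ) ≤ n := by exact_mod_cast h
      exact le_trans (by nlinarith) (neg_le_abs _)

lemma UU_lat (r : ℝ) (hr : 0 < r) (z : ℂ) (hz : z ∈ UU r) (hz0 : z ≠ 0) :
    z ∉ (LL r hr).lattice := by
  intro h
  have := UU_dist r hr z hz z h hz0
  rw [sub_self, norm_zero] at this
  have h2 : 0 < min (Real.pi / 2) r := lt_min (by positivity) hr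
  linarith

lemma hasDerivAt_Wr (r : ℝ) (hr : 0 < r) (z : ℂ) (hz : z ∈ UU r) :
    HasDerivAt (Wr r hr) (-(LL r hr).weierstrassPExcept 0 z) z := by
  set ε := min (Real.pi / 2) r with hε
  have hε0 : 0 < ε := lt_min (by positivity) hr
  set M := 3 * Real.pi / 2 + r with hM
  have hM0 : 0 < M := by positivity
  have hs : Summable (fun l : (LL r hr).lattice =>
      (10 * M + 2 / ε ^ 2 * (2 * M) ^ 3) * ‖l‖ ^ (-3 : ℝ)) :=
    (ZLattice.summable_norm_rpow _ _ (by simp; norm_num)).mul_left _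
  have hder := hasDerivAt_tsum_of_isPreconnected (𝕜 := ℂ) (F := ℂ)
    (g := fun (l : (LL r hr).lattice) z => if (l : ℂ) = 0 then 0 else
      (1 / (z - l) + 1 / (l : ℂ) + z / (l : ℂ) ^ 2))
    (g' := fun (l : (LL r hr).lattice) z => -if (l : ℂ) = 0 then 0 else
      (1 / (z - l) ^ 2 - 1 / (l : ℂ) ^ 2)) (t := UU r) (y₀ := 0) (y := z) hs (UU_open r)
    (UU_convex r).isPreconnected ?_ ?_ (UU_zero r hr) ?_ hz
  · rw [tsum_neg] at hder
    exact hder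
  · intro l y hy
    by_cases hl : (l : ℂ) = 0
    · simp only [hl, if_true, neg_zero]
      exact hasDerivAt_const _ _
    · simp only [hl, if_false]
      have hne : y - l ≠ 0 := by
        have := UU_dist r hr y hy l l.2 hl
        rw [← norm_pos_iff]
        linarith
      have h1 : HasDerivAt (fun w : ℂ => w - l) 1 y := (hasDerivAt_id y).sub_const _
      have h2 := ((hasDerivAt_const y (1 : ℂ)).div h1 hne)
      have h3 := (h2.add_const (1 / (l : ℂ))).add ((hasDerivAt_id y).div_const ((l : ℂ) ^ 2))
      refine h3.congr_deriv ?_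
      field_simp
      ring
  · intro l y hy
    rw [norm_neg]
    by_cases hl : (l : ℂ) = 0
    · simp only [hl, if_true, norm_zero]
      positivity
    · simp only [hl, if_false]
      have hyM : ‖y‖ < M := by
        refine (Complex.norm_le_abs_re_add_abs_im y).trans_lt ?_
        exact add_lt_add (abs_lt.mpr hy.1) (abs_lt.mpr hy.2)
      have hpos : 0 < ‖(l : ℂ)‖ := norm_pos_iff.mpr hl
      have hn : 0 ≤ ‖(l : ℂ)‖ ^ (-3 : ℝ) := by positivity
      have hcast : ‖l‖ = ‖(l : ℂ)‖ := rfl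
      rw [hcast]
      by_cases hb : 2 * M ≤ ‖(l : ℂ)‖
      · refine (PeriodPair.weierstrassP_bound M hM0 y hyM l hb).trans ?_
        have : 0 ≤ 2 / ε ^ 2 * (2 * M) ^ 3 := by positivity
        gcongr
        linarith
      · push Not at hb
        have d1 := UU_dist r hr y hy l l.2 hl
        have d2 := UU_dist r hr 0 (UU_zero r hr) l l.2 hl
        rw [zero_sub, norm_neg] at d2
        have b1 : ‖1 / (y - l) ^ 2 - 1 / (l : ℂ) ^ 2‖ ≤ 2 / ε ^ 2 := by
          refine (norm_sub_le _ _).trans ?_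
          rw [norm_div, norm_div, norm_pow, norm_pow, norm_one,
            show 2 / ε ^ 2 = 1 / ε ^ 2 + 1 / ε ^ 2 by ring]
          gcongr
        have b2 : 1 ≤ (2 * M) ^ 3 * ‖(l : ℂ)‖ ^ (-3 : ℝ) := by
          rw [Real.rpow_neg hpos.le, ← div_eq_mul_inv, one_le_div (by positivity)]
          rw [show (3 : ℝ) = ((3 : ℕ) : ℝ) by norm_num, Real.rpow_natCast]
          gcongr
        have h3 : 0 ≤ 2 / ε ^ 2 := by positivity
        have h4 : 0 ≤ 10 * M * ‖(l : ℂ)‖ ^ (-3 : ℝ) := by positivity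
        nlinarith
  · refine summable_zero.congr ?_
    intro l
    by_cases hl : (l : ℂ) = 0
    · simp [hl]
    · simp [hl]

end NV
namespace NV

noncomputable def ph (r : ℝ) (z : ℂ) : ℂ := dslope (TT 0 r) 0 z

lemma TT_ph (r : ℝ) (z : ℂ) : TT 0 r z = z * ph r z := by
  have := sub_smul_dslope (TT 0 r) 0 z
  rw [TT_zero_zero, smul_eq_mul] at this
  simp only [sub_zero] at this
  exact this.symm

lemma differentiable_ph (r : ℝ) (hr : 0 < r) : Differentiable ℂ (ph r) := by
  have := (Complex.differentiableOn_dslope (s := Set.univ) (c := (0 : ℂ)) (f := TT 0 r)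
    Filter.univ_mem).mpr (differentiable_TT 0 r hr).differentiableOn
  exact differentiableOn_univ.mp this

lemma ph_zero (r : ℝ) (hr : 0 < r) : ph r 0 = TT 1 r 0 := by
  unfold ph
  rw [dslope_same, deriv_TT 0 r hr]

lemma ph_ne (r : ℝ) (hr : 0 < r) (z : ℂ) (hz : z ∈ UU r) : ph r z ≠ 0 := by
  obtain ⟨hne, h1⟩ := theta_struct r hr
  by_cases h0 : z = 0
  · rw [h0, ph_zero r hr]; exact h1
  · intro h
    apply hne z (UU_lat r hr z hz h0)
    rw [TT_ph, h, mul_zero]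

noncomputable def ph1 (r : ℝ) : ℂ → ℂ := deriv (ph r)
noncomputable def ph2 (r : ℝ) : ℂ → ℂ := deriv (ph1 r)

lemma differentiable_ph1 (r : ℝ) (hr : 0 < r) : Differentiable ℂ (ph1 r) := by
  have := (differentiable_ph r hr).contDiff (n := 2)
  exact (this.differentiable_deriv_two)

lemma differentiable_ph2 (r : ℝ) (hr : 0 < r) : Differentiable ℂ (ph2 r) := by
  have := (differentiable_ph1 r hr).contDiff (n := 2)
  exact (this.differentiable_deriv_two)

lemma TT1_ph (r : ℝ) (hr : 0 < r) (z : ℂ) : TT 1 r z = ph r z + z * ph1 r z := by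
  have h : HasDerivAt (fun z => z * ph r z) (1 * ph r z + z * ph1 r z) z :=
    (hasDerivAt_id z).mul (differentiable_ph r hr z).hasDerivAt
  have h2 := hasDerivAt_TT_z 0 r hr z
  rw [show TT 0 r = fun z => z * ph r z from funext (TT_ph r)] at h2
  rw [h2.unique h, one_mul]

lemma TT2_ph (r : ℝ) (hr : 0 < r) (z : ℂ) : TT 2 r z = 2 * ph1 r z + z * ph2 r z := by
  have h : HasDerivAt (fun z => ph r z + z * ph1 r z)
      (ph1 r z + (1 * ph1 r z + z * ph2 r z)) z :=
    (differentiable_ph r hr z).hasDerivAt.add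
      ((hasDerivAt_id z).mul (differentiable_ph1 r hr z).hasDerivAt)
  have h2 := hasDerivAt_TT_z 1 r hr z
  rw [show TT 1 r = fun z => ph r z + z * ph1 r z from funext (TT1_ph r hr)] at h2
  rw [h2.unique h]; ring

lemma TT3_ph (r : ℝ) (hr : 0 < r) : TT 3 r 0 = 3 * ph2 r 0 := by
  have h : HasDerivAt (fun z => 2 * ph1 r z + z * ph2 r z)
      (2 * ph2 r 0 + (1 * ph2 r 0 + 0 * deriv (ph2 r) 0)) 0 :=
    ((differentiable_ph1 r hr 0).hasDerivAt.const_mul 2).add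
      ((hasDerivAt_id (0:ℂ)).mul (differentiable_ph2 r hr 0).hasDerivAt)
  have h2 := hasDerivAt_TT_z 2 r hr 0
  rw [show TT 2 r = fun z => 2 * ph1 r z + z * ph2 r z from funext (TT2_ph r hr)] at h2
  rw [h2.unique h]; ring

lemma ph1_zero (r : ℝ) (hr : 0 < r) : ph1 r 0 = 0 := by
  have h := TT2_ph r hr 0
  rw [TT_two_zero] at h
  linear_combination -h / 2

noncomputable def GG (r : ℝ) (z : ℂ) : ℂ := ph2 r z / ph r z - (ph1 r z / ph r z) ^ 2

lemma hasDerivAt_q (r : ℝ) (hr : 0 < r) (z : ℂ) (hz : ph r z ≠ 0) :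
    HasDerivAt (fun z => ph1 r z / ph r z) (GG r z) z := by
  refine ((differentiable_ph1 r hr z).hasDerivAt.div
    (differentiable_ph r hr z).hasDerivAt hz).congr_deriv ?_
  change (ph2 r z * ph r z - ph1 r z * ph1 r z) / ph r z ^ 2 = GG r z
  unfold GG
  field_simp

lemma FF_ph (r : ℝ) (hr : 0 < r) (z : ℂ) (h0 : z ≠ 0) (hz : ph r z ≠ 0) :
    FF r z = 1 / z + ph1 r z / ph r z := by
  unfold FF
  rw [TT1_ph r hr, TT_ph]
  field_simp

lemma DF_ph (r : ℝ) (hr : 0 < r) (z : ℂ) (h0 : z ≠ 0) (hz : ph r z ≠ 0) :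
    DF r z = -1 / z ^ 2 + GG r z := by
  unfold DF GG
  rw [FF_ph r hr z h0 hz, TT2_ph r hr, TT_ph]
  field_simp
  ring

lemma P_ex (r : ℝ) (hr : 0 < r) (z : ℂ) :
    (LL r hr).weierstrassP z = (LL r hr).weierstrassPExcept 0 z + 1 / z ^ 2 := by
  have := (LL r hr).weierstrassPExcept_add 0 z
  rw [← this]
  simp

lemma cont_Pex (r : ℝ) (hr : 0 < r) : ContinuousAt ((LL r hr).weierstrassPExcept 0) 0 :=
  (((LL r hr).differentiableOn_weierstrassPExcept 0).differentiableAt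
      ((LL r hr).compl_lattice_sdiff_singleton_mem_nhds 0)).continuousAt

lemma cont_GG (r : ℝ) (hr : 0 < r) : ContinuousAt (GG r) 0 := by
  have h := ph_ne r hr 0 (UU_zero r hr)
  unfold GG
  exact ((differentiable_ph2 r hr 0).continuousAt.div (differentiable_ph r hr 0).continuousAt h).sub
    (((differentiable_ph1 r hr 0).continuousAt.div (differentiable_ph r hr 0).continuousAt h).pow 2)

lemma DP_eq (r : ℝ) (hr : 0 < r) (z : ℂ) (hz : z ∈ UU r) (h0 : z ≠ 0) :
    DF r z + (LL r hr).weierstrassP z = GG r z + (LL r hr).weierstrassPExcept 0 z := by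
  rw [DF_ph r hr z h0 (ph_ne r hr z hz), P_ex]
  ring

lemma DP_lim (r : ℝ) (hr : 0 < r) :
    Tendsto (fun z => DF r z + (LL r hr).weierstrassP z) (𝓝[≠] 0) (𝓝 (GG r 0)) := by
  have h : Tendsto (fun z => GG r z + (LL r hr).weierstrassPExcept 0 z) (𝓝[≠] 0)
      (𝓝 (GG r 0 + (LL r hr).weierstrassPExcept 0 0)) :=
    (((cont_GG r hr).add (cont_Pex r hr)).tendsto).mono_left nhdsWithin_le_nhds
  rw [PeriodPair.weierstrassPExcept_zero, add_zero] at h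
  refine h.congr' ?_
  filter_upwards [self_mem_nhdsWithin, nhdsWithin_le_nhds ((UU_open r).mem_nhds (UU_zero r hr))]
    with z h0 hz
  exact (DP_eq r hr z hz h0).symm

lemma DP_const (r : ℝ) (hr : 0 < r) (z : ℂ) (hz : z ∉ (LL r hr).lattice) :
    DF r z + (LL r hr).weierstrassP z = GG r 0 := by
  obtain ⟨hne, -⟩ := theta_struct r hr
  obtain ⟨C, hC⟩ := elliptic_const (LL r hr) (fun z => DF r z + (LL r hr).weierstrassP z)
    (LL r hr).lattice (lat_disc _) (fun z hz => (differentiableAt_DF r hr z (hne z hz)).add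
      ((LL r hr).differentiableOn_weierstrassP.differentiableAt
        ((LL r hr).isClosed_lattice.isOpen_compl.mem_nhds hz))) (by
      apply per_ext (LL r hr) (fun z => DF r z + (LL r hr).weierstrassP z) _ (lat_shift _)
      · intro z hz
        have h2 := (LL r hr).weierstrassP_add_coe z ⟨_, (LL r hr).ω₁_mem_lattice⟩
        simp only at h2
        simp only [h2]
        congr 1
        exact DF_add_two_pi r z
      · intro z hz
        have h2 := (LL r hr).weierstrassP_add_coe z ⟨_, (LL r hr).ω₂_mem_lattice⟩
        simp only at h2
        simp only [h2]
        congr 1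
        exact DF_add_ir r hr z (hne z hz)) (by
      intro z hz
      refine ⟨-z, neg_mem hz, GG r 0, ?_⟩
      rw [add_neg_cancel]
      exact DP_lim r hr)
  have hlim : Tendsto (fun z => DF r z + (LL r hr).weierstrassP z) (𝓝[≠] 0) (𝓝 C) := by
    refine tendsto_const_nhds.congr' ?_
    filter_upwards [lat_disc (LL r hr) 0] with w hw
    exact (hC w hw).symm
  have := tendsto_nhds_unique hlim (DP_lim r hr)
  rw [← this]
  exact hC z hz

lemma GP_const (r : ℝ) (hr : 0 < r) (z : ℂ) (hz : z ∈ UU r) :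
    GG r z + (LL r hr).weierstrassPExcept 0 z = GG r 0 := by
  by_cases h0 : z = 0
  · rw [h0, PeriodPair.weierstrassPExcept_zero, add_zero]
  · rw [← DP_eq r hr z hz h0]
    exact DP_const r hr z (UU_lat r hr z hz h0)

lemma pi_UU (r : ℝ) (hr : 0 < r) : (Real.pi : ℂ) ∈ UU r := by
  have := Real.pi_pos
  simp only [UU, Set.mem_ofPred_eq, Complex.ofReal_re, Complex.ofReal_im, Set.mem_Ioo]
  refine ⟨⟨?_, ?_⟩, ?_, ?_⟩ <;> linarith

lemma neg_pi_UU (r : ℝ) (hr : 0 < r) : (-Real.pi : ℂ) ∈ UU r := by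
  have := Real.pi_pos
  simp only [UU, Set.mem_ofPred_eq, Complex.neg_re, Complex.neg_im,
    Complex.ofReal_re, Complex.ofReal_im, Set.mem_Ioo]
  refine ⟨⟨?_, ?_⟩, ?_, ?_⟩ <;> linarith

lemma c_eta (r : ℝ) (hr : 0 < r) :
    TT 3 r 0 / TT 1 r 0 = -3 * (wzeta r Real.pi / Real.pi) := by
  have hpi : (Real.pi : ℂ) ≠ 0 := by exact_mod_cast Real.pi_ne_zero
  have hd : ∀ z ∈ UU r, HasDerivAt (fun z => ph1 r z / ph r z - Wr r hr z - GG r 0 * z) 0 z := by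
    intro z hz
    refine (((hasDerivAt_q r hr z (ph_ne r hr z hz)).sub (hasDerivAt_Wr r hr z hz)).sub
      ((hasDerivAt_id z).const_mul (GG r 0))).congr_deriv ?_
    rw [← GP_const r hr z hz]
    ring
  have hc := (UU_open r).is_const_of_deriv_eq_zero (UU_convex r).isPreconnected
    (fun z hz => (hd z hz).differentiableAt.differentiableWithinAt)
    (fun z hz => (hd z hz).deriv) (pi_UU r hr) (neg_pi_UU r hr)
  have e1 := FF_ph r hr _ hpi (ph_ne r hr _ (pi_UU r hr))
  have e2 := FF_ph r hr _ (neg_ne_zero.mpr hpi) (ph_ne r hr _ (neg_pi_UU r hr))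
  have f1 : FF r Real.pi = 0 := by unfold FF; rw [TT_one_pi, zero_div]
  rw [FF_neg, f1] at e2
  rw [f1] at e1
  simp only [Wr_neg] at hc
  have hw := wzeta_eq r hr Real.pi
  have hG : GG r 0 = ph2 r 0 / ph r 0 := by
    unfold GG
    rw [ph1_zero r hr]; simp
  rw [TT3_ph r hr, ← ph_zero r hr, mul_div_assoc, ← hG]
  have e3 : (1 : ℂ) / -Real.pi = -(1 / Real.pi) := by rw [div_neg]
  rw [e3] at e2
  have : GG r 0 * Real.pi = - wzeta r Real.pi := by
    rw [hw]
    linear_combination (-1/2) * hc - (1/2) * e1 + (1/2) * e2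
  rw [mul_div_assoc'] 
  rw [eq_div_iff hpi]
  linear_combination 3 * this

end NV
namespace NV

noncomputable def AA (k : ℕ) (r x : ℝ) : ℝ := (TT k r x).re

lemma AA_coe (k : ℕ) (r x : ℝ) : ((AA k r x : ℝ) : ℂ) = TT k r x := TT_real k r x

lemma hasDerivAt_AA (k : ℕ) (r : ℝ) (hr : 0 < r) (x : ℝ) :
    HasDerivAt (AA k r) (AA (k + 1) r x) x :=
  (hasDerivAt_TT_z k r hr x).real_of_complex

lemma hasDerivAt_AA_r (k : ℕ) (r : ℝ) (hr : 0 < r) (x : ℝ) :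
    HasDerivAt (fun s => AA k s x) (AA (k + 2) r x) r :=
  (Complex.reCLM.hasFDerivAt.comp_hasDerivAt r (hasDerivAt_TT_r k r hr x) :)

noncomputable def FR (r x : ℝ) : ℝ := AA 1 r x / AA 0 r x
noncomputable def DR (r x : ℝ) : ℝ := AA 2 r x / AA 0 r x - FR r x ^ 2

lemma FR_coe (r x : ℝ) : ((FR r x : ℝ) : ℂ) = FF r x := by
  unfold FR FF
  push_cast
  rw [AA_coe, AA_coe]

lemma DR_coe (r x : ℝ) : ((DR r x : ℝ) : ℂ) = DF r x := by
  unfold DR DF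
  push_cast
  rw [AA_coe, AA_coe, FR_coe]

lemma hasDerivAt_FR (r : ℝ) (hr : 0 < r) (x : ℝ) (hx : AA 0 r x ≠ 0) :
    HasDerivAt (FR r) (DR r x) x := by
  refine ((hasDerivAt_AA 1 r hr x).div (hasDerivAt_AA 0 r hr x) hx).congr_deriv ?_
  unfold DR FR
  field_simp

lemma Hker_eq (r : ℝ) (hr : 0 < r) : Hker r = fun z => 2 * FF r z := by
  funext z
  unfold Hker FF
  rw [Theta_eq, deriv_TT 0 r hr, mul_div_assoc]

lemma Hker_re (r : ℝ) (hr : 0 < r) (x : ℝ) : (Hker r (x : ℂ)).re = 2 * FR r x := by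
  rw [Hker_eq r hr]
  simp only [← FR_coe]
  norm_cast

lemma Hker_deriv_re (r : ℝ) (hr : 0 < r) (x : ℝ) (hx : AA 0 r x ≠ 0) :
    (deriv (Hker r) (x : ℂ)).re = 2 * DR r x := by
  have h : TT 0 r x ≠ 0 := by rw [← AA_coe]; exact_mod_cast hx
  rw [Hker_eq r hr, ((hasDerivAt_FF r hr x h).const_mul 2).deriv, ← DR_coe]
  norm_cast

lemma not_lat (r : ℝ) (hr : 0 < r) (x : ℝ) (h0 : 0 < x) (h1 : x < 2 * Real.pi) :
    (x : ℂ) ∉ (LL r hr).lattice := by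
  rw [PeriodPair.mem_lattice]
  rintro ⟨m, n, h⟩
  have h2 := congrArg Complex.re h
  simp [LL] at h2
  have hpi := Real.pi_pos
  have hm0 : (0 : ℝ) < m := by
    by_contra hc
    push Not at hc
    nlinarith
  have hm1 : (m : ℝ) < 1 := by
    by_contra hc
    push Not at hc
    nlinarith
  have a : 0 < m := by exact_mod_cast hm0
  have b : m < 1 := by exact_mod_cast hm1
  omega

lemma AA_ne (r : ℝ) (hr : 0 < r) (x : ℝ) (h0 : 0 < x) (h1 : x < 2 * Real.pi) :
    AA 0 r x ≠ 0 := by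
  intro h
  apply (theta_struct r hr).1 x (not_lat r hr x h0 h1)
  rw [← AA_coe, h, Complex.ofReal_zero]

lemma AA_one_ne (r : ℝ) (hr : 0 < r) : AA 1 r 0 ≠ 0 := by
  intro h
  apply (theta_struct r hr).2
  have := AA_coe 1 r 0
  rw [h, Complex.ofReal_zero] at this
  exact this.symm

lemma rpow_log {f : ℝ → ℝ} {f' t : ℝ} (a : ℝ) (hf : HasDerivAt f f' t) (h0 : f t ≠ 0) :
    HasDerivAt (fun t => f t ^ a) (f t ^ a * (a * (f' / f t))) t := by
  refine (hf.rpow_const (p := a) (Or.inl h0)).congr_deriv ?_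
  rw [Real.rpow_sub_one h0]
  field_simp

/-- key real identity -/
lemma key_real (r : ℝ) (hr : 0 < r) (u v : ℝ) (hu : 0 < u) (hv : 0 < v)
    (huv : u + v < 2 * Real.pi) :
    (FR r (u + v) - FR r u - FR r v) ^ 2 + (DR r (u + v) + DR r u + DR r v) =
      AA 3 r 0 / AA 1 r 0 := by
  have h := EE_const r hr v u (not_lat r hr v hv (by linarith)) (not_lat r hr u hu (by linarith))
    (by rw [← Complex.ofReal_add]; exact not_lat r hr _ (by linarith) huv)
  unfold EE at h
  have e3 := AA_coe 3 r 0
  have e1 := AA_coe 1 r 0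
  rw [Complex.ofReal_zero] at e3 e1
  rw [← Complex.ofReal_add, ← FR_coe, ← FR_coe, ← FR_coe, ← DR_coe, ← DR_coe, ← DR_coe,
    ← e3, ← e1] at h
  exact_mod_cast h

lemma c_eta_real (r : ℝ) (hr : 0 < r) :
    AA 3 r 0 / AA 1 r 0 = -3 * ((wzeta r (Real.pi : ℂ)).re / Real.pi) := by
  have h := c_eta r hr
  have e3 := AA_coe 3 r 0
  have e1 := AA_coe 1 r 0
  rw [Complex.ofReal_zero] at e3 e1
  rw [← e3, ← e1] at h
  have h2 := congrArg Complex.re h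
  rw [← Complex.ofReal_div, Complex.ofReal_re] at h2
  rw [h2, show (-3 : ℂ) = ((-3 : ℝ) : ℂ) by norm_num, Complex.re_ofReal_mul, Complex.div_ofReal_re]

lemma Zsharp_eq (κ q r p ζ : ℝ) (hr : 0 < r) : Zsharp κ q r p ζ =
    AA 1 r 0 ^ ((6 : ℝ) / κ) * AA 0 r (p - q) ^ ((2 : ℝ) / κ) *
      AA 0 r (p - ζ) ^ (-((4 : ℝ) / κ)) * AA 0 r (ζ - q) ^ (-((4 : ℝ) / κ)) := by
  unfold Zsharp AA
  rw [Theta_eq, deriv_TT 0 r hr, Complex.ofReal_zero]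

lemma Z_r (κ q r p ζ : ℝ) (hr : 0 < r) (h1 : q < ζ) (h2 : ζ < p) (h3 : p < q + 2 * Real.pi) :
    HasDerivAt (fun s => Zsharp κ q s p ζ) (Zsharp κ q r p ζ *
      (6 / κ * (AA 3 r 0 / AA 1 r 0) + 2 / κ * (AA 2 r (p - q) / AA 0 r (p - q)) -
        4 / κ * (AA 2 r (p - ζ) / AA 0 r (p - ζ)) -
        4 / κ * (AA 2 r (ζ - q) / AA 0 r (ζ - q)))) r := by
  have d1 := rpow_log (6 / κ) (hasDerivAt_AA_r 1 r hr 0) (AA_one_ne r hr)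
  have d2 := rpow_log (2 / κ) (hasDerivAt_AA_r 0 r hr (p - q))
    (AA_ne r hr _ (by linarith) (by linarith))
  have d3 := rpow_log (-(4 / κ)) (hasDerivAt_AA_r 0 r hr (p - ζ))
    (AA_ne r hr _ (by linarith) (by linarith))
  have d4 := rpow_log (-(4 / κ)) (hasDerivAt_AA_r 0 r hr (ζ - q))
    (AA_ne r hr _ (by linarith) (by linarith))
  have h := ((d1.mul d2).mul d3).mul d4
  have h' := h.congr_of_eventuallyEq (f₁ := fun s => Zsharp κ q s p ζ) (by
    filter_upwards [lt_mem_nhds hr] with s hs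
    exact Zsharp_eq κ q s p ζ hs)
  refine h'.congr_deriv ?_
  rw [Zsharp_eq κ q r p ζ hr]
  simp only [Pi.mul_apply]
  ring

lemma Z_p (κ q r p ζ : ℝ) (hr : 0 < r) (h1 : q < ζ) (h2 : ζ < p) (h3 : p < q + 2 * Real.pi) :
    HasDerivAt (fun p => Zsharp κ q r p ζ) (Zsharp κ q r p ζ *
      (2 / κ * FR r (p - q) - 4 / κ * FR r (p - ζ))) p := by
  have d1 := hasDerivAt_const p (AA 1 r 0 ^ (6 / κ))
  have d2 := rpow_log (2 / κ) ((hasDerivAt_AA 0 r hr (p - q)).comp_sub_const p q)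
    (AA_ne r hr _ (by linarith) (by linarith))
  have d3 := rpow_log (-(4 / κ)) ((hasDerivAt_AA 0 r hr (p - ζ)).comp_sub_const p ζ)
    (AA_ne r hr _ (by linarith) (by linarith))
  have d4 := hasDerivAt_const p (AA 0 r (ζ - q) ^ (-(4 / κ)))
  have h := ((d1.mul d2).mul d3).mul d4
  have h' := h.congr_of_eventuallyEq (f₁ := fun p => Zsharp κ q r p ζ) (by
    filter_upwards with s
    exact Zsharp_eq κ q r s ζ hr)
  refine h'.congr_deriv ?_
  rw [Zsharp_eq κ q r p ζ hr]
  simp only [Pi.mul_apply, FR]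
  ring

lemma Z_pp (κ q r p ζ : ℝ) (hr : 0 < r) (h1 : q < ζ) (h2 : ζ < p) (h3 : p < q + 2 * Real.pi) :
    deriv (fun p' => deriv (fun p'' => Zsharp κ q r p'' ζ) p') p = Zsharp κ q r p ζ *
      ((2 / κ * FR r (p - q) - 4 / κ * FR r (p - ζ)) ^ 2 +
        (2 / κ * DR r (p - q) - 4 / κ * DR r (p - ζ))) := by
  have he : (fun p' => deriv (fun p'' => Zsharp κ q r p'' ζ) p') =ᶠ[𝓝 p]
      (fun p => Zsharp κ q r p ζ * (2 / κ * FR r (p - q) - 4 / κ * FR r (p - ζ))) := by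
    filter_upwards [lt_mem_nhds h2, gt_mem_nhds h3] with s a b
    exact (Z_p κ q r s ζ hr h1 a b).deriv
  rw [he.deriv_eq]
  have f1 := (hasDerivAt_FR r hr (p - q)
    (AA_ne r hr _ (by linarith) (by linarith))).comp_sub_const p q
  have f2 := (hasDerivAt_FR r hr (p - ζ)
    (AA_ne r hr _ (by linarith) (by linarith))).comp_sub_const p ζ
  have h := (Z_p κ q r p ζ hr h1 h2 h3).mul ((f1.const_mul (2 / κ)).sub (f2.const_mul (4 / κ)))
  refine h.deriv.trans ?_
  simp only [Pi.sub_apply]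
  ring

lemma Z_t (κ q r p ζ : ℝ) (hr : 0 < r) (h1 : q < ζ) (h2 : ζ < p) (h3 : p < q + 2 * Real.pi) :
    HasDerivAt (fun t => Zsharp κ q r p t) (Zsharp κ q r p ζ *
      (4 / κ * FR r (p - ζ) - 4 / κ * FR r (ζ - q))) ζ := by
  have d1 := hasDerivAt_const ζ (AA 1 r 0 ^ (6 / κ) * AA 0 r (p - q) ^ (2 / κ))
  have d3 := rpow_log (-(4 / κ)) ((hasDerivAt_AA 0 r hr (p - ζ)).comp_const_sub p ζ)
    (AA_ne r hr _ (by linarith) (by linarith))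
  have d4 := rpow_log (-(4 / κ)) ((hasDerivAt_AA 0 r hr (ζ - q)).comp_sub_const ζ q)
    (AA_ne r hr _ (by linarith) (by linarith))
  have h := (d1.mul d3).mul d4
  have h' := h.congr_of_eventuallyEq (f₁ := fun t => Zsharp κ q r p t) (by
    filter_upwards with s
    exact Zsharp_eq κ q r p s hr)
  refine h'.congr_deriv ?_
  rw [Zsharp_eq κ q r p ζ hr]
  simp only [Pi.mul_apply, FR]
  ring

end NV

/-- Null-vector equation for the screening integrand (excursion-reflected case). -/
theorem null_vector_screening_integrand (κ : ℝ) (hκ : 0 < κ) (q : ℝ)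
    (r : ℝ) (hr : 0 < r) (p ζ : ℝ)
    (h1 : q < ζ) (h2 : ζ < p) (h3 : p < q + 2 * Real.pi) :
    deriv (fun s => Zsharp κ q s p ζ) r =
      κ / 2 * deriv (fun p' => deriv (fun p'' => Zsharp κ q r p'' ζ) p') p +
      (Hker r ((p - q : ℝ) : ℂ)).re * deriv (fun p' => Zsharp κ q r p' ζ) p +
      (3 / κ - 1 / 2) * (deriv (Hker r) ((p - q : ℝ) : ℂ)).re * Zsharp κ q r p ζ -
      6 / κ * ((wzeta r (Real.pi : ℂ)).re / Real.pi) * Zsharp κ q r p ζ +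
      deriv (fun t =>
        ((Hker r ((p - q : ℝ) : ℂ)).re - (Hker r ((p - t : ℝ) : ℂ)).re) *
          Zsharp κ q r p t) ζ := by
  have n1 := NV.AA_ne r hr (p - q) (by linarith) (by linarith)
  have n2 := NV.AA_ne r hr (p - ζ) (by linarith) (by linarith)
  have hk := NV.key_real r hr (p - ζ) (ζ - q) (by linarith) (by linarith) (by linarith)
  rw [show p - ζ + (ζ - q) = p - q by ring, NV.c_eta_real r hr] at hk
  have f2 := (NV.hasDerivAt_FR r hr (p - ζ) n2).comp_const_sub p ζ
  have ht : HasDerivAt (fun t => ((Hker r ((p - q : ℝ) : ℂ)).re -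
      (Hker r ((p - t : ℝ) : ℂ)).re) * Zsharp κ q r p t)
      (2 * NV.DR r (p - ζ) * Zsharp κ q r p ζ +
        (2 * NV.FR r (p - q) - 2 * NV.FR r (p - ζ)) * (Zsharp κ q r p ζ *
      (4 / κ * NV.FR r (p - ζ) - 4 / κ * NV.FR r (ζ - q)))) ζ := by
    simp only [NV.Hker_re r hr]
    refine (((f2.const_mul 2).const_sub (2 * NV.FR r (p - q))).mul
      (NV.Z_t κ q r p ζ hr h1 h2 h3)).congr_deriv ?_
    ring
  rw [ht.deriv, NV.Z_pp κ q r p ζ hr h1 h2 h3, (NV.Z_p κ q r p ζ hr h1 h2 h3).deriv,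
    (NV.Z_r κ q r p ζ hr h1 h2 h3).deriv, NV.Hker_re r hr, NV.Hker_deriv_re r hr _ n1,
    NV.c_eta_real r hr]
  have g : ∀ x, NV.AA 2 r x / NV.AA 0 r x = NV.DR r x + NV.FR r x ^ 2 := by
    intro x
    unfold NV.DR
    ring
  rw [g, g, g]
  have hκ0 := hκ.ne'
  generalize (wzeta r (Real.pi : ℂ)).re / Real.pi = η at *
  generalize Zsharp κ q r p ζ = Z at *
  field_simp
  linear_combination (-8) * Z * hk
end
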